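/- arXiv:1212.4597 — 3 statements merged into one kernel-verified Lean document; each statement's English description precedes it below -/
import Mathlib

section
/- Let P be a quasi-identity of M_n and let c be a central polynomial of M_n with zero constant term. Then there exists m ∈ ℕ such that c^m · P (product taken in C⟨X⟩) is a consequence of the Cayley–Hamilton identity, i.e. c^m · P lies in the T-ideal of C⟨X⟩ generated by q_n. -/
open scoped TensorProduct

variable (F : Type*) [Field F] [CharZero F] (n : ℕ)

/-- The commutative coefficient ring `C = F[x_{ij}^{(k)}]`. -/
abbrev CPoly := MvPolynomial (Fin n × Fin n × ℕ) F

/-- The algebra of quasi-polynomials `C⟨X⟩`. -/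
abbrev QPoly := FreeAlgebra (CPoly F n) ℕ

/-- The generic matrix `ξ_k`. -/
noncomputable def genMat (k : ℕ) : Matrix (Fin n) (Fin n) (CPoly F n) :=
  Matrix.of fun i j => MvPolynomial.X (i, j, k)

/-- `Φ : C⟨X⟩ → M_n(C)`, the `C`-algebra map sending `x_k` to `ξ_k`. -/
noncomputable def PhiQ : QPoly F n →ₐ[CPoly F n] Matrix (Fin n) (Fin n) (CPoly F n) :=
  FreeAlgebra.lift _ (genMat F n)

/-- Evaluation of `C` at a sequence of matrices. -/
noncomputable def evalC (A : ℕ → Matrix (Fin n) (Fin n) F) : CPoly F n →ₐ[F] F :=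
  MvPolynomial.aeval fun p => A p.2.2 p.1 p.2.1

/-- Evaluation `ev_A : C⟨X⟩ → M_n(F)`. -/
noncomputable def evalQ (A : ℕ → Matrix (Fin n) (Fin n) F) :
    QPoly F n →ₐ[F] Matrix (Fin n) (Fin n) F :=
  ((evalC F n A).mapMatrix).comp ((PhiQ F n).restrictScalars F)

def IsQuasiIdentity (P : QPoly F n) : Prop :=
  ∀ A : ℕ → Matrix (Fin n) (Fin n) F, evalQ F n A P = 0

/-- Substitution endomorphisms of `C⟨X⟩`. -/
def IsSubstEndo (φ : QPoly F n →ₐ[F] QPoly F n) : Prop :=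
  ∀ (i j : Fin n) (k : ℕ),
    φ (algebraMap (CPoly F n) (QPoly F n) (MvPolynomial.X (i, j, k))) =
      algebraMap (CPoly F n) (QPoly F n) (PhiQ F n (φ (FreeAlgebra.ι (CPoly F n) k)) i j)

def IsTIdeal (I : Set (QPoly F n)) : Prop :=
  (0 : QPoly F n) ∈ I ∧
  (∀ a b : QPoly F n, a ∈ I → b ∈ I → a + b ∈ I) ∧
  (∀ r a : QPoly F n, a ∈ I → r * a ∈ I) ∧
  (∀ r a : QPoly F n, a ∈ I → a * r ∈ I) ∧
  (∀ φ : QPoly F n →ₐ[F] QPoly F n, IsSubstEndo F n φ → ∀ p ∈ I, φ p ∈ I)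

/-- The T-ideal generated by a set. -/
def TIdealSpan (S : Set (QPoly F n)) : Set (QPoly F n) :=
  ⋂₀ {I : Set (QPoly F n) | IsTIdeal F n I ∧ S ⊆ I}

/-- The Cayley–Hamilton quasi-polynomial `q_n`. -/
noncomputable def chQ : QPoly F n :=
  ∑ i ∈ Finset.range (n + 1),
    algebraMap (CPoly F n) (QPoly F n) ((genMat F n 0).charpoly.coeff i) *
      FreeAlgebra.ι (CPoly F n) 0 ^ i

/-- Noncommutative polynomials over `F`. -/
abbrev NCPoly := FreeAlgebra F ℕ

noncomputable def evalNC (A : ℕ → Matrix (Fin n) (Fin n) F) :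
    NCPoly F →ₐ[F] Matrix (Fin n) (Fin n) F :=
  FreeAlgebra.lift F A

def IsCentralPoly (c : NCPoly F) : Prop :=
  ∀ A : ℕ → Matrix (Fin n) (Fin n) F, ∃ α : F,
    evalNC F n A c = α • (1 : Matrix (Fin n) (Fin n) F)

def IsPolyIdentity (c : NCPoly F) : Prop :=
  ∀ A : ℕ → Matrix (Fin n) (Fin n) F, evalNC F n A c = 0

/-- The constant term of a noncommutative polynomial. -/
noncomputable def constantTerm : NCPoly F →ₐ[F] F :=
  FreeAlgebra.lift F (fun _ : ℕ => (0 : F))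

/-- The inclusion `F⟨X⟩ → C⟨X⟩`. -/
noncomputable def toQPoly : NCPoly F →ₐ[F] QPoly F n :=
  FreeAlgebra.lift F (fun k => FreeAlgebra.ι (CPoly F n) k)

section Algebra

open Polynomial

/-- Adding a nilpotent to a central non-zero-divisor preserves left regularity. -/
theorem eq_zero_of_add_nilpotent_mul {Q : Type*} [Ring Q] {d k z : Q} (hd : ∀ w, Commute d w)
    (htf : ∀ w, d * w = 0 → w = 0) {N : ℕ} (hk : k ^ N = 0) (h : (d + k) * z = 0) : z = 0 := by
  have key : d ^ N * z = 0 := by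
    rcases N.eq_zero_or_pos with rfl | hN
    · have : (1 : Q) = 0 := by simpa using hk
      rw [← one_mul z, this]; simp
    · have := (hd (-k)).geom_sum₂_mul N
      rw [neg_pow, hk, mul_zero, sub_zero, sub_neg_eq_add] at this
      rw [← this, mul_assoc, h, mul_zero]
  clear hk
  induction N with
  | zero => simpa using key
  | succ N ih => exact ih (htf _ (by rw [← mul_assoc, ← pow_succ', key]))

/-- Adding a nilpotent to a central non-zero-divisor preserves right regularity. -/
theorem eq_zero_of_mul_add_nilpotent {Q : Type*} [Ring Q] {d k z : Q} (hd : ∀ w, Commute d w)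
    (htf : ∀ w, d * w = 0 → w = 0) {N : ℕ} (hk : k ^ N = 0) (h : z * (d + k) = 0) : z = 0 := by
  have key : d ^ N * z = 0 := by
    rcases N.eq_zero_or_pos with rfl | hN
    · have : (1 : Q) = 0 := by simpa using hk
      rw [← one_mul z, this]; simp
    · have := (hd (-k)).mul_geom_sum₂ N
      rw [neg_pow, hk, mul_zero, sub_zero, sub_neg_eq_add] at this
      rw [((hd z).pow_left N).eq, ← this, ← mul_assoc, h, zero_mul]
  clear hk
  induction N with
  | zero => simpa using key
  | succ N ih => exact ih (htf _ (by rw [← mul_assoc, ← pow_succ', key]))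

/-- If `e` is a multiple of an idempotent by a central non-zero-divisor, `y` lies in its corner, is
nilpotent, and `e + y` satisfies the characteristic equation of a rank one element, then `y = 0`. -/
theorem corner_eq_zero {Q : Type*} [Ring Q] {d e y : Q} (hd : ∀ w, Commute d w)
    (htf : ∀ w, d * w = 0 → w = 0) {N M : ℕ} (hee : e * e = d * e) (hey : e * y = d * y)
    (hye : y * e = d * y) (hy : y ^ M = 0) (hx : (e + y) ^ N * (e + y - d) = 0) : y = 0 := by
  have h1 : (e + y - d) * e = d * y := by
    rw [sub_mul, add_mul, hee, hye]; abel
  have h2 : (e + y) ^ N * y = 0 := by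
    apply htf
    rw [← mul_assoc, ((hd ((e + y) ^ N)).eq), mul_assoc, ← h1, ← mul_assoc, hx, zero_mul]
  have h3 : (e + y) * y = y * (d + y) := by
    rw [add_mul, mul_add, hey, (hd y).eq]
  have h4 : ∀ j, (e + y) ^ j * y = y * (d + y) ^ j := by
    intro j
    induction j with
    | zero => simp
    | succ j ih => rw [pow_succ, mul_assoc, h3, ← mul_assoc, ih, mul_assoc, ← pow_succ]
  rw [h4] at h2
  clear h4 hx
  induction N with
  | zero => simpa using h2
  | succ N ih =>
    rw [pow_succ, ← mul_assoc] at h2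
    exact ih (by simpa using eq_zero_of_mul_add_nilpotent hd htf hy h2)

theorem charpoly_single_zero_zero {R : Type*} [CommRing R] (N : ℕ) (d : R) :
    (Matrix.single (0 : Fin (N + 1)) 0 d).charpoly = X ^ N * (X - C d) := by
  rw [← Matrix.diagonal_single, Matrix.charpoly_diagonal, Fin.prod_univ_succ]
  simp [mul_comm]

theorem single_zero_zero_pow {R : Type*} [CommRing R] {N : ℕ} (d : R) (k : ℕ) :
    (Matrix.single (0 : Fin (N + 1)) (0 : Fin (N + 1)) d) ^ (k + 1) =
      Matrix.single 0 0 (d ^ (k + 1)) := by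
  induction k with
  | zero => simp
  | succ k ih => rw [pow_succ, ih, Matrix.single_mul_single_same, ← pow_succ]

/-- Let `B` be an `R`-algebra with a map `Φ` to matrices, and `π : B → Q` a ring map through which
every element of `B` satisfies the characteristic polynomial of its image under `Φ`. If some `δ`
acts regularly on `Q` and conducts all matrix units into the image of `Φ`, then `π` kills the
kernel of `Φ`. -/
theorem map_eq_zero_of_conductor {R B Q : Type*} [CommRing R] [Ring B] [Algebra R B] [Ring Q]
    {N : ℕ} (Φ : B →ₐ[R] Matrix (Fin (N + 1)) (Fin (N + 1)) R) (π : B →+* Q)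
    (hπ : Function.Surjective π)
    (hCH : ∀ b, π (aeval b (Φ b).charpoly) = 0) (δ : R)
    (htf : ∀ z, π (algebraMap R B δ) * z = 0 → z = 0)
    (hδ : ∀ i j, ∃ b, Φ b = Matrix.single i j δ) (P : B) (hP : Φ P = 0) : π P = 0 := by
  have hcomm : ∀ (r : R) (w : Q), Commute (π (algebraMap R B r)) w := by
    intro r w
    obtain ⟨b, rfl⟩ := hπ w
    exact (Algebra.commute_algebraMap_left r b).map π
  have htfk : ∀ (k : ℕ) (z : Q), π (algebraMap R B (δ ^ k)) * z = 0 → z = 0 := by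
    intro k
    induction k with
    | zero => simp
    | succ k ih =>
      intro z hz
      apply htf
      apply ih
      rwa [← mul_assoc, ← map_mul, ← map_mul, ← pow_succ]
  have hnil : ∀ b, Φ b = 0 → π b ^ (N + 1) = 0 := by
    intro b hb
    simpa [hb, Matrix.charpoly_zero] using hCH b
  have hrank : ∀ b d, Φ b = Matrix.single 0 0 d →
      π b ^ N * (π b - π (algebraMap R B d)) = 0 := by
    intro b d hb
    simpa [hb, charpoly_single_zero_zero] using hCH b
  choose u hu using hδ
  set a := u 0 0
  set D := π (algebraMap R B δ)
  have hstep : π a ^ (N + 1) = D * π a ^ N := by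
    have := hrank a δ (hu 0 0)
    rw [mul_sub, sub_eq_zero] at this
    rw [pow_succ, this, (hcomm δ _).eq]
  have hak : ∀ j, π a ^ (N + j) = D ^ j * π a ^ N := by
    intro j
    induction j with
    | zero => simp
    | succ j ih =>
      rw [← add_assoc, pow_succ, ih, mul_assoc, ← pow_succ, hstep, ← mul_assoc, ← pow_succ]
  set e := a ^ (N + 1) with he
  set d := δ ^ (N + 1) with hd
  have hΦe : Φ e = Matrix.single 0 0 d := by rw [he, map_pow, hu, single_zero_zero_pow]
  have hee : π e * π e = π (algebraMap R B d) * π e := by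
    rw [he, hd, map_pow, map_pow, map_pow, ← pow_add,
      show N + 1 + (N + 1) = N + (N + 2) by ring, hak, hstep, ← mul_assoc, ← pow_succ]
  have hcorner : ∀ x, Φ x = 0 → π (e * x * e) = 0 := by
    intro x hx
    refine corner_eq_zero (hcomm d) (htfk (N + 1)) (e := π e) (N := N) hee ?_ ?_
      (hnil _ (by simp [hx])) ?_
    · simp only [map_mul, ← mul_assoc, hee]
    · simp only [map_mul, mul_assoc, hee]
      rw [(hcomm d (π e * (π x * π e))).eq, (hcomm d (π e)).eq]
      simp only [mul_assoc]
    · rw [← map_add]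
      exact hrank _ _ (by simp [hx, hΦe])
  set S := ∑ i, u i 0 * e * u 0 i with hS
  set g := δ * d * δ with hg
  have hΦS : Φ (S - algebraMap R B g) = 0 := by
    have : ∀ i, Φ (u i 0 * e * u 0 i) = Matrix.single i i g := by
      intro i
      simp [hu, hΦe, hg]
    rw [map_sub, hS, map_sum, AlgHom.commutes, sub_eq_zero]
    simp only [this]
    rw [Matrix.sum_single_eq_diagonal, Matrix.algebraMap_eq_diagonal]
    rfl
  have hSPS : π S * π P * π S = 0 := by
    rw [← map_mul, ← map_mul, hS, Finset.sum_mul, Finset.sum_mul, map_sum]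
    refine Finset.sum_eq_zero fun i _ => ?_
    rw [Finset.mul_sum, map_sum]
    refine Finset.sum_eq_zero fun j _ => ?_
    rw [show u i 0 * e * u 0 i * P * (u j 0 * e * u 0 j) =
      u i 0 * (e * (u 0 i * P * u j 0) * e) * u 0 j by simp only [mul_assoc],
      map_mul, map_mul, hcorner _ (by simp [hP])]
    simp
  have hSk : π S = π (algebraMap R B g) + π (S - algebraMap R B g) := by
    rw [← map_add]; congr 1; abel
  have htfg : ∀ z, π (algebraMap R B g) * z = 0 → z = 0 := by
    have : g = δ ^ (N + 3) := by rw [hg, hd]; ring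
    rw [this]
    exact htfk _
  rw [hSk] at hSPS
  exact eq_zero_of_add_nilpotent_mul (hcomm g) htfg (hnil _ hΦS)
    (eq_zero_of_mul_add_nilpotent (hcomm g) htfg (hnil _ hΦS) hSPS)

end Algebra

section Burnside

/-- **Burnside's theorem**: over an algebraically closed field, an algebra of endomorphisms of a
finite-dimensional space without nontrivial invariant subspaces consists of all endomorphisms. -/
theorem Subalgebra.eq_top_of_forall_invariant {k V : Type*} [Field k] [IsAlgClosed k]
    [AddCommGroup V] [Module k V] [FiniteDimensional k V] [Nontrivial V]
    (S : Subalgebra k (Module.End k V))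
    (h : ∀ W : Submodule k V, (∀ s ∈ S, ∀ w ∈ W, s w ∈ W) → W = ⊥ ∨ W = ⊤) : S = ⊤ := by
  have hsimple : IsSimpleModule S V := by
    have : IsSimpleOrder (Submodule S V) :=
      { eq_bot_or_eq_top := fun W => by
          rcases h (W.restrictScalars k) fun s hs w hw => W.smul_mem ⟨s, hs⟩ hw with h0 | h0
          · exact Or.inl ((Submodule.restrictScalars_eq_bot_iff k S V).1 h0)
          · exact Or.inr ((Submodule.restrictScalars_eq_top_iff k S V).1 h0) }
    exact { }
  refine eq_top_iff.2 fun f _ => ?_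
  let f' : Module.End (Module.End S V) V :=
    { toFun := f
      map_add' := f.map_add
      map_smul' := fun g v => by
        obtain ⟨t, rfl⟩ :=
          (IsSimpleModule.algebraMap_end_bijective_of_isAlgClosed (A := S) (V := V) k).2 g
        simp }
  let b := Module.finBasis k V
  obtain ⟨r, hr⟩ := jacobson_density f' (Finset.univ.map ⟨b, b.injective⟩)
  have : f = r := b.ext fun i => hr (b i) (by simp)
  rw [this]
  exact r.2

/-- Matrices over an algebraically closed field at which a suitable noncommutative polynomial does
not vanish have no common invariant subspace, hence generate the full matrix algebra. -/
theorem adjoin_range_eq_top {F k ι : Type*} [CommRing F] [Field k] [IsAlgClosed k] [Algebra F k]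
    {n : ℕ} [NeZero n] (c : FreeAlgebra F ι)
    (hc : ∀ M : ι → Matrix (Fin n) (Fin n) k, ∃ a : k, FreeAlgebra.lift F M c = a • 1)
    (hc0 : FreeAlgebra.lift F (fun _ : ι => (0 : F)) c = 0)
    (M : ι → Matrix (Fin n) (Fin n) k) (hM : FreeAlgebra.lift F M c ≠ 0) :
    Algebra.adjoin k (Set.range M) = ⊤ := by
  let V := Fin n → k
  let τ : Matrix (Fin n) (Fin n) k ≃ₐ[k] Module.End k V := Matrix.toLinAlgEquiv'
  suffices h : (Algebra.adjoin k (Set.range M)).map τ.toAlgHom = ⊤ by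
    refine eq_top_iff.2 fun x _ => ?_
    have hx : τ x ∈ (Algebra.adjoin k (Set.range M)).map τ.toAlgHom := h ▸ Algebra.mem_top
    obtain ⟨y, hy, hyx⟩ := hx
    rwa [← τ.injective hyx]
  apply Subalgebra.eq_top_of_forall_invariant
  intro W hW
  by_contra! hne
  obtain ⟨hbot, htop⟩ := hne
  obtain ⟨W', hWW'⟩ := W.exists_isCompl
  let p : Module.End k V := W.projection W' hWW'
  let M' : ι → Matrix (Fin n) (Fin n) k := fun l => τ.symm (τ (M l) * p)
  have hinv : ∀ l, ∀ w ∈ W, τ (M l) w ∈ W := fun l w hw =>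
    hW _ ⟨M l, Algebra.subset_adjoin ⟨l, rfl⟩, rfl⟩ w hw
  have key : ∀ q : FreeAlgebra F ι,
      (∀ w ∈ W, τ (FreeAlgebra.lift F M q) w ∈ W ∧
        τ (FreeAlgebra.lift F M' q) w = τ (FreeAlgebra.lift F M q) w) ∧
      ∀ w ∈ W', τ (FreeAlgebra.lift F M' q) w =
        algebraMap F k (FreeAlgebra.lift F (fun _ : ι => (0 : F)) q) • w := by
    intro q
    induction q using FreeAlgebra.induction with
    | grade0 r =>
      have h : ∀ w, τ (algebraMap F _ r) w = algebraMap F k r • w := by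
        intro w
        rw [IsScalarTower.algebraMap_apply F k, AlgEquiv.commutes]
        rfl
      simp only [AlgHom.commutes, h]
      exact ⟨fun w hw => ⟨W.smul_mem _ hw, trivial⟩, fun w _ => rfl⟩
    | grade1 l =>
      simp only [FreeAlgebra.lift_ι_apply, M', AlgEquiv.apply_symm_apply, Module.End.mul_apply]
      refine ⟨fun w hw => ⟨hinv l w hw, ?_⟩, fun w hw => ?_⟩
      · rw [show p w = w from Submodule.projection_apply_left hWW' ⟨w, hw⟩]
      · rw [show p w = 0 from (Submodule.projection_apply_eq_zero_iff hWW').2 hw]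
        simp
    | mul x y hx hy =>
      simp only [map_mul, Module.End.mul_apply]
      refine ⟨fun w hw => ⟨(hx.1 _ (hy.1 w hw).1).1, ?_⟩, fun w hw => ?_⟩
      · rw [(hy.1 w hw).2, (hx.1 _ (hy.1 w hw).1).2]
      · rw [hy.2 w hw, map_smul, hx.2 w hw, smul_smul, mul_comm]
    | add x y hx hy =>
      simp only [map_add, LinearMap.add_apply]
      refine ⟨fun w hw => ⟨W.add_mem (hx.1 w hw).1 (hy.1 w hw).1, ?_⟩, fun w hw => ?_⟩
      · rw [(hx.1 w hw).2, (hy.1 w hw).2]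
      · rw [hx.2 w hw, hy.2 w hw, add_smul]
  obtain ⟨key1, key2⟩ := key c
  obtain ⟨a, ha⟩ := hc M
  obtain ⟨a', ha'⟩ := hc M'
  have hW' : W' ≠ ⊥ := by
    rintro rfl
    exact htop (eq_top_of_isCompl_bot hWW')
  obtain ⟨w', hw', hw'0⟩ := W'.ne_bot_iff.1 hW'
  obtain ⟨w, hw, hw0⟩ := W.ne_bot_iff.1 hbot
  have h1 := key2 w' hw'
  have h2 := (key1 w hw).2
  simp only [ha, ha', hc0, map_smul, map_one, map_zero, zero_smul, LinearMap.smul_apply,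
    Module.End.one_apply, smul_eq_zero, hw'0, or_false] at h1 h2
  rw [h1, zero_smul, eq_comm, smul_eq_zero] at h2
  apply hM
  rw [ha, h2.resolve_right hw0, zero_smul]

end Burnside

section Conductor

/-- If a submodule of `ι → R` spans `ι → k` after base change to a field `k`, then some element of
`R` with nonzero image in `k` multiplies all of `ι → R` into the submodule. -/
theorem exists_smul_mem_of_span_eq_top {R k ι : Type*} [CommRing R] [Field k] [Algebra R k]
    [Fintype ι] [DecidableEq ι] (G : Submodule R (ι → R))
    (hG : Submodule.span k ((fun v i => algebraMap R k (v i)) '' (G : Set (ι → R))) = ⊤) :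
    ∃ η : R, algebraMap R k η ≠ 0 ∧ ∀ x, η • x ∈ G := by
  obtain ⟨b, hb, hspan, hli⟩ :=
    exists_linearIndependent k ((fun v i => algebraMap R k (v i)) '' (G : Set (ι → R)))
  let B : Module.Basis b k (ι → k) := .mk hli (by rw [Subtype.range_coe, hspan, hG])
  let B' := B.reindex (B.indexEquiv (Pi.basisFun k ι))
  have hB' : ∀ i, ∃ v ∈ G, (fun j => algebraMap R k (v j)) = B' i := by
    intro i
    have : B' i ∈ b := by simp [B', B]
    exact hb this
  choose v hv hvB using hB'
  let W : Matrix ι ι R := Matrix.of v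
  refine ⟨W.det, ?_, fun x => ?_⟩
  · rw [RingHom.map_det, ← isUnit_iff_ne_zero, ← Matrix.isUnit_iff_isUnit_det,
      ← Matrix.linearIndependent_rows_iff_isUnit]
    convert B'.linearIndependent using 1
    funext i
    exact hvB i
  · have : W.det • x = ∑ i, (Matrix.vecMul x W.adjugate) i • v i := by
      have h : Matrix.vecMul (Matrix.vecMul x W.adjugate) W = W.det • x := by
        rw [Matrix.vecMul_vecMul, Matrix.adjugate_mul, Matrix.vecMul_smul, Matrix.vecMul_one]
      rw [← h, Matrix.vecMul_eq_sum]
      rfl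
    rw [this]
    exact G.sum_mem fun i _ => G.smul_mem _ (hv i)

end Conductor

set_option linter.unusedSectionVars false

section Generic

theorem PhiQ_eq_zero_of_isQuasiIdentity {P : QPoly F n} (hP : IsQuasiIdentity F n P) :
    PhiQ F n P = 0 := by
  ext1 i j
  apply MvPolynomial.funext
  intro x
  exact congr($(hP fun k => Matrix.of fun i j => x (i, j, k)) i j)

/-- Evaluating a noncommutative polynomial at matrices over an `F`-algebra factors through its value
at generic matrices. -/
theorem lift_eq_map_PhiQ_toQPoly {k : Type*} [CommRing k] [Algebra F k]
    (M : ℕ → Matrix (Fin n) (Fin n) k) (c : NCPoly F) :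
    FreeAlgebra.lift F M c =
      (MvPolynomial.aeval (R := F) fun p : Fin n × Fin n × ℕ => M p.2.2 p.1 p.2.1).mapMatrix
        (PhiQ F n (toQPoly F n c)) := by
  have : FreeAlgebra.lift F M =
      ((MvPolynomial.aeval (R := F) fun p : Fin n × Fin n × ℕ => M p.2.2 p.1 p.2.1).mapMatrix).comp
        (((PhiQ F n).restrictScalars F).comp (toQPoly F n)) := by
    ext l i j
    simp [toQPoly, PhiQ, genMat]
  rw [this]
  rfl

/-- The value of a central polynomial at generic matrices is scalar. -/
theorem exists_PhiQ_toQPoly_eq_smul [NeZero n] {c : NCPoly F} (hc : IsCentralPoly F n c) :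
    ∃ α : CPoly F n, PhiQ F n (toQPoly F n c) = α • 1 := by
  refine ⟨PhiQ F n (toQPoly F n c) 0 0, ?_⟩
  ext1 i j
  apply MvPolynomial.funext
  intro x
  obtain ⟨a, ha⟩ := hc fun k => Matrix.of fun i j => x (i, j, k)
  rw [evalNC, lift_eq_map_PhiQ_toQPoly] at ha
  have h : ∀ i j, MvPolynomial.eval x (PhiQ F n (toQPoly F n c) i j) =
    (a • (1 : Matrix (Fin n) (Fin n) F)) i j := fun i j => congr($ha i j)
  rw [h, Matrix.smul_apply, Matrix.smul_apply, smul_eq_mul, smul_eq_mul, map_mul, h]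
  by_cases hij : i = j
  · subst hij
    simp
  · simp [hij]

/-- The value of a central polynomial without constant term lies in every prime ideal containing the
conductor of the image of `PhiQ`. -/
theorem exists_conductor_notMem [NeZero n] {c : NCPoly F} (hc0 : constantTerm F c = 0)
    {α : CPoly F n} (hα : PhiQ F n (toQPoly F n c) = α • 1)
    (p : Ideal (CPoly F n)) [p.IsPrime] (hp : α ∉ p) :
    ∃ η, η ∉ p ∧ ∀ x, ∃ b, PhiQ F n b = η • x := by
  let k := AlgebraicClosure (FractionRing (CPoly F n ⧸ p))
  have hker : ∀ r, algebraMap (CPoly F n) k r = 0 ↔ r ∈ p := by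
    intro r
    rw [IsScalarTower.algebraMap_apply (CPoly F n) (FractionRing (CPoly F n ⧸ p)) k, map_eq_zero,
      IsScalarTower.algebraMap_apply (CPoly F n) (CPoly F n ⧸ p) (FractionRing (CPoly F n ⧸ p)),
      IsFractionRing.to_map_eq_zero_iff]
    exact Ideal.Quotient.eq_zero_iff_mem
  let M : ℕ → Matrix (Fin n) (Fin n) k := fun l => (genMat F n l).map (algebraMap (CPoly F n) k)
  have hcent : ∀ M : ℕ → Matrix (Fin n) (Fin n) k,
      FreeAlgebra.lift F M c =
        (MvPolynomial.aeval (R := F) fun p : Fin n × Fin n × ℕ => M p.2.2 p.1 p.2.1) α • 1 := by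
    intro M
    rw [lift_eq_map_PhiQ_toQPoly, hα]
    ext i j
    simp only [AlgHom.mapMatrix_apply, Matrix.map_apply, Matrix.smul_apply, Matrix.one_apply]
    split_ifs <;> simp
  have hMα : (MvPolynomial.aeval (R := F) fun p : Fin n × Fin n × ℕ => M p.2.2 p.1 p.2.1) α =
      algebraMap (CPoly F n) k α := by
    have : MvPolynomial.aeval (R := F) (fun p : Fin n × Fin n × ℕ => M p.2.2 p.1 p.2.1) =
        IsScalarTower.toAlgHom F (CPoly F n) k := by
      ext q
      simp [M, genMat]
    rw [this]
    rfl
  have htop := adjoin_range_eq_top c (fun M => ⟨_, hcent M⟩) hc0 M (by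
    rw [hcent, hMα]
    intro h
    have := congr($h 0 0)
    simp [hker, hp] at this)
  let L : (Fin n × Fin n → CPoly F n) ≃ₗ[CPoly F n] Matrix (Fin n) (Fin n) (CPoly F n) :=
    LinearEquiv.curry _ _ _ _
  obtain ⟨η, hη, hx⟩ := exists_smul_mem_of_span_eq_top (k := k)
    ((LinearMap.range (PhiQ F n).toLinearMap).comap L.toLinearMap) (by
      let L' : (Fin n × Fin n → k) ≃ₗ[k] Matrix (Fin n) (Fin n) k := LinearEquiv.curry _ _ _ _
      have := congr(Subalgebra.toSubmodule $htop)
      rw [Algebra.adjoin_eq_span, Algebra.top_toSubmodule] at this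
      rw [← Submodule.map_eq_top_iff (e := L'), Submodule.map_span, eq_top_iff, ← this]
      apply Submodule.span_mono
      intro y hy
      have hy' : ∃ b, (PhiQ F n b).map (algebraMap (CPoly F n) k) = y := by
        induction hy using Submonoid.closure_induction with
        | mem y hy =>
          obtain ⟨l, rfl⟩ := hy
          exact ⟨FreeAlgebra.ι _ l, by simp [PhiQ, M]⟩
        | one => exact ⟨1, by simp⟩
        | mul x y _ _ hx hy =>
          obtain ⟨a, rfl⟩ := hx
          obtain ⟨b, rfl⟩ := hy
          exact ⟨a * b, by rw [map_mul, Matrix.map_mul]⟩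
      obtain ⟨b, rfl⟩ := hy'
      exact ⟨_, ⟨L.symm (PhiQ F n b), ⟨b, (L.apply_symm_apply _).symm⟩, rfl⟩, rfl⟩)
  refine ⟨η, by rwa [Ne, hker] at hη, fun x => ?_⟩
  obtain ⟨b, hb⟩ := hx (L.symm x)
  exact ⟨b, hb.trans (by simp)⟩

/-- Some power of the value of a central polynomial without constant term multiplies all matrices
into the image of `PhiQ`. -/
theorem exists_pow_smul_mem_range_PhiQ [NeZero n] {c : NCPoly F} (hc0 : constantTerm F c = 0)
    {α : CPoly F n} (hα : PhiQ F n (toQPoly F n c) = α • 1) :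
    ∃ m : ℕ, ∀ x, ∃ b, PhiQ F n b = α ^ m • x := by
  let D : Ideal (CPoly F n) := (LinearMap.range (PhiQ F n).toLinearMap).colon Set.univ
  have hD : ∀ r, r ∈ D ↔ ∀ x, ∃ b, PhiQ F n b = r • x := by
    intro r
    simp [D, Submodule.mem_colon]
  suffices α ∈ D.radical by
    obtain ⟨m, hm⟩ := this
    exact ⟨m, (hD _).1 hm⟩
  rw [Ideal.radical_eq_sInf, Ideal.mem_sInf]
  rintro p ⟨hDp, hp⟩
  by_contra hαp
  obtain ⟨η, hη, hx⟩ := exists_conductor_notMem F n hc0 hα p hαp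
  exact hη (hDp ((hD η).2 hx))

end Generic

section TIdeal

/-- A ring map out of a free algebra is determined by arbitrary images of the generators and a
ring map on coefficients with central image. -/
theorem FreeAlgebra.exists_ringHom {R B X : Type*} [CommRing R] [Ring B] (g : R →+* B)
    (hg : ∀ r b, Commute (g r) b) (h : X → B) :
    ∃ φ : FreeAlgebra R X →+* B, (∀ r, φ (algebraMap R _ r) = g r) ∧
      ∀ x, φ (FreeAlgebra.ι R x) = h x := by
  let : Algebra R B := g.toAlgebra' hg
  exact ⟨(FreeAlgebra.lift R h : FreeAlgebra R X →ₐ[R] B),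
    fun r => (FreeAlgebra.lift R h).commutes r, fun x => FreeAlgebra.lift_ι_apply h x⟩

/-- Every quasi-polynomial `H` is the common value of all variables under some substitution. -/
theorem exists_isSubstEndo (H : QPoly F n) :
    ∃ φ : QPoly F n →ₐ[F] QPoly F n, IsSubstEndo F n φ ∧
      (∀ k, φ (FreeAlgebra.ι _ k) = H) ∧
      ∀ r, φ (algebraMap (CPoly F n) _ r) = algebraMap (CPoly F n) _
        (MvPolynomial.aeval (R := F) (fun p : Fin n × Fin n × ℕ => PhiQ F n H p.1 p.2.1) r) := by
  let ψ : CPoly F n →ₐ[F] CPoly F n :=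
    MvPolynomial.aeval (R := F) fun p : Fin n × Fin n × ℕ => PhiQ F n H p.1 p.2.1
  obtain ⟨φ, hφC, hφX⟩ := FreeAlgebra.exists_ringHom
    ((algebraMap (CPoly F n) (QPoly F n)).comp ψ.toRingHom)
    (fun r b => Algebra.commute_algebraMap_left (ψ r) b) (fun _ : ℕ => H)
  let φ' : QPoly F n →ₐ[F] QPoly F n :=
    { φ with
      commutes' := fun r => by
        change φ (algebraMap F (QPoly F n) r) = _
        rw [IsScalarTower.algebraMap_apply F (CPoly F n) (QPoly F n), hφC]
        exact congrArg (algebraMap (CPoly F n) (QPoly F n)) (ψ.commutes r) }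
  refine ⟨φ', fun i j k => ?_, hφX, hφC⟩
  change φ _ = algebraMap _ _ (PhiQ F n (φ _) i j)
  rw [hφC, hφX]
  simp [ψ]

theorem isTIdeal_TIdealSpan (S : Set (QPoly F n)) : IsTIdeal F n (TIdealSpan F n S) := by
  refine ⟨?_, ?_, ?_, ?_, ?_⟩
  · exact fun I hI => hI.1.1
  · exact fun a b ha hb I hI => hI.1.2.1 a b (ha I hI) (hb I hI)
  · exact fun r a ha I hI => hI.1.2.2.1 r a (ha I hI)
  · exact fun r a ha I hI => hI.1.2.2.2.1 r a (ha I hI)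
  · exact fun φ hφ p hp I hI => hI.1.2.2.2.2 φ hφ p (hp I hI)

/-- Every quasi-polynomial satisfies, modulo the consequences of the Cayley–Hamilton identity, the
characteristic polynomial of its generic value. -/
theorem aeval_charpoly_mem_TIdealSpan (H : QPoly F n) :
    Polynomial.aeval H (PhiQ F n H).charpoly ∈ TIdealSpan F n {chQ F n} := by
  obtain ⟨φ, hφ, hX, hC⟩ := exists_isSubstEndo F n H
  have hmem : φ (chQ F n) ∈ TIdealSpan F n {chQ F n} :=
    (isTIdeal_TIdealSpan F n _).2.2.2.2 φ hφ _ fun I hI => hI.2 rfl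
  have hmap : (genMat F n 0).map
      (MvPolynomial.aeval (R := F) fun p : Fin n × Fin n × ℕ => PhiQ F n H p.1 p.2.1).toRingHom =
        PhiQ F n H := by
    ext i j
    simp [genMat]
  convert hmem using 1
  have hdeg : (PhiQ F n H).charpoly.natDegree < n + 1 := by
    rw [Matrix.charpoly_natDegree_eq_dim, Fintype.card_fin]
    exact n.lt_succ_self
  rw [Polynomial.aeval_eq_sum_range' hdeg, chQ, map_sum]
  refine Finset.sum_congr rfl fun i _ => ?_
  rw [map_mul, map_pow, hX, hC, Algebra.smul_def]
  congr 2
  rw [← hmap, Matrix.charpoly_map, Polynomial.coeff_map, hmap]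
  rfl

/-- The elements of a T-ideal, as a two-sided ideal. -/
noncomputable def IsTIdeal.toTwoSidedIdeal {I : Set (QPoly F n)} (hI : IsTIdeal F n I) :
    TwoSidedIdeal (QPoly F n) :=
  .mk' I hI.1 (fun ha hb => hI.2.1 _ _ ha hb) (fun {x} hx => neg_one_mul x ▸ hI.2.2.1 (-1) x hx)
    (fun hb => hI.2.2.1 _ _ hb) (fun ha => hI.2.2.2.1 _ _ ha)

/-- The elements carried into a two-sided ideal by some power of a central element `a`. -/
def TwoSidedIdeal.powTorsion {B : Type*} [Ring B] (I : TwoSidedIdeal B) (a : B)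
    (ha : ∀ b, Commute a b) : TwoSidedIdeal B :=
  .mk' {x | ∃ m : ℕ, a ^ m * x ∈ I}
    ⟨0, by simp [I.zero_mem]⟩
    (by
      rintro x y ⟨m, hm⟩ ⟨l, hl⟩
      refine ⟨m + l, ?_⟩
      rw [mul_add]
      refine I.add_mem ?_ ?_
      · rw [add_comm, pow_add, mul_assoc]
        exact I.mul_mem_left _ _ hm
      · rw [pow_add, mul_assoc]
        exact I.mul_mem_left _ _ hl)
    (by
      rintro x ⟨m, hm⟩
      exact ⟨m, by simpa using I.neg_mem hm⟩)
    (by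
      rintro x y ⟨m, hm⟩
      refine ⟨m, ?_⟩
      rw [← mul_assoc, ((ha x).pow_left m).eq, mul_assoc]
      exact I.mul_mem_left _ _ hm)
    (by
      rintro x y ⟨m, hm⟩
      refine ⟨m, ?_⟩
      rw [← mul_assoc]
      exact I.mul_mem_right _ _ hm)

theorem TwoSidedIdeal.mem_powTorsion {B : Type*} [Ring B] {I : TwoSidedIdeal B} {a : B}
    {ha : ∀ b, Commute a b} {x : B} : x ∈ I.powTorsion a ha ↔ ∃ m : ℕ, a ^ m * x ∈ I := by
  simp [powTorsion]

theorem TwoSidedIdeal.mk'_eq_zero_iff {B : Type*} [Ring B] (I : TwoSidedIdeal B) {x : B} :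
    I.ringCon.mk' x = 0 ↔ x ∈ I := by
  rw [← TwoSidedIdeal.mem_ker, TwoSidedIdeal.ker_ringCon_mk']

/-- If `c` differs from `a` by a commuting element nilpotent modulo `I`, then powers of `c` carry
into `I` whatever powers of `a` do. -/
theorem TwoSidedIdeal.exists_pow_mul_mem {B : Type*} [Ring B] {I : TwoSidedIdeal B} {a c x : B}
    (hac : Commute a c) {N M : ℕ} (hN : (c - a) ^ N ∈ I) (hM : a ^ M * x ∈ I) :
    c ^ (N + M) * x ∈ I := by
  have hcomm : Commute (c - a) a := hac.symm.sub_left (Commute.refl a)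
  nth_rw 1 [← sub_add_cancel c a]
  rw [hcomm.add_pow', Finset.sum_mul]
  refine sum_mem fun ij hij => ?_
  rw [Finset.HasAntidiagonal.mem_antidiagonal] at hij
  rw [smul_mul_assoc]
  refine I.nsmul_mem _ ?_
  rcases le_total N ij.1 with h | h
  · rw [← Nat.sub_add_cancel h, pow_add, mul_assoc, mul_assoc]
    exact I.mul_mem_left _ _ (I.mul_mem_right _ _ hN)
  · have h' : M ≤ ij.2 := by omega
    rw [← Nat.sub_add_cancel h', pow_add, ← mul_assoc, mul_assoc]
    exact I.mul_mem_left _ _ hM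

end TIdeal

theorem stmt0 (F : Type*) [Field F] [CharZero F] (n : ℕ) (hn : 1 ≤ n)
    (P : QPoly F n) (hP : IsQuasiIdentity F n P)
    (c : NCPoly F) (hc : IsCentralPoly F n c) (hc0 : constantTerm F c = 0) :
    ∃ m : ℕ, (toQPoly F n c) ^ m * P ∈ TIdealSpan F n {chQ F n} := by
  have : NeZero n := ⟨by omega⟩
  obtain ⟨α, hα⟩ := exists_PhiQ_toQPoly_eq_smul F n hc
  obtain ⟨m, hm⟩ := exists_pow_smul_mem_range_PhiQ F n hc0 hα
  let a := algebraMap (CPoly F n) (QPoly F n) α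
  have ha : ∀ b, Commute a b := Algebra.commute_algebraMap_left α
  let I := (isTIdeal_TIdealSpan F n {chQ F n}).toTwoSidedIdeal
  have hI : ∀ x, x ∈ I ↔ x ∈ TIdealSpan F n {chQ F n} := fun x => TwoSidedIdeal.mem_mk' ..
  let T := I.powTorsion a ha
  have hT : P ∈ T := by
    obtain ⟨N, rfl⟩ : ∃ N, n = N + 1 := ⟨n - 1, by omega⟩
    rw [← T.mk'_eq_zero_iff]
    refine map_eq_zero_of_conductor (PhiQ F _) T.ringCon.mk' T.ringCon.mk'_surjective
      (fun b => ?_) (α ^ m) ?_ (fun i j => ?_) P (PhiQ_eq_zero_of_isQuasiIdentity F _ hP)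
    · rw [T.mk'_eq_zero_iff, TwoSidedIdeal.mem_powTorsion]
      exact ⟨0, by simpa using (hI _).2 (aeval_charpoly_mem_TIdealSpan F _ b)⟩
    · intro z hz
      obtain ⟨z, rfl⟩ := T.ringCon.mk'_surjective z
      rw [← map_mul, T.mk'_eq_zero_iff, TwoSidedIdeal.mem_powTorsion] at hz
      obtain ⟨l, hl⟩ := hz
      rw [T.mk'_eq_zero_iff, TwoSidedIdeal.mem_powTorsion]
      exact ⟨l + m, by rwa [map_pow, ← mul_assoc, ← pow_add] at hl⟩
    · obtain ⟨b, hb⟩ := hm (Matrix.single i j 1)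
      exact ⟨b, by simpa using hb⟩
  obtain ⟨M, hM⟩ := TwoSidedIdeal.mem_powTorsion.1 hT
  have hnil : (toQPoly F n c - a) ^ n ∈ I := by
    have h0 : PhiQ F n (toQPoly F n c - a) = 0 := by
      rw [map_sub, AlgHom.commutes, hα, Algebra.algebraMap_eq_smul_one, sub_self]
    have := aeval_charpoly_mem_TIdealSpan F n (toQPoly F n c - a)
    rw [h0, Matrix.charpoly_zero] at this
    simpa [hI] using this
  exact ⟨n + M, (hI _).1 (TwoSidedIdeal.exists_pow_mul_mem (ha _) hnil hM)⟩
end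

section
/- For every integer n ≥ 2 there exists a quasi-identity of M_n that is not a consequence of the Cayley–Hamilton identity; that is, the T-ideal I_n of all quasi-identities of M_n strictly contains the T-ideal of C⟨X⟩ generated by q_n. -/
open scoped TensorProduct

variable (F : Type*) [Field F] [CharZero F] (n : ℕ)

open Matrix in
/-- The Bézoutian `(χ(s) - χ(t)) / (s - t)` of the characteristic polynomial `χ` of `z`,
evaluated at `s = z ⊗ 1` and `t = 1 ⊗ z`. -/
noncomputable def bezoutKronecker {R : Type*} [CommRing R] {n : ℕ}
    (z : Matrix (Fin n) (Fin n) R) : Matrix (Fin n × Fin n) (Fin n × Fin n) R :=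
  ∑ i ∈ Finset.range n, ∑ j ∈ Finset.range n,
    z.charpoly.coeff (i + j + 1) • kroneckerMap (· * ·) (z ^ i) (z ^ j)

section Bezout

open Matrix Finset
open scoped Kronecker

variable {R : Type*} [CommRing R] {n : ℕ}

theorem sum_charpoly_coeff_smul_pow (z : Matrix (Fin n) (Fin n) R) :
    ∑ i ∈ range (n + 1), z.charpoly.coeff i • z ^ i = 0 := by
  nontriviality R
  have h := z.aeval_self_charpoly
  rwa [Polynomial.aeval_eq_sum_range, z.charpoly_natDegree_eq_dim, Fintype.card_fin] at h

theorem charpoly_coeff_eq_zero (z : Matrix (Fin n) (Fin n) R) {k : ℕ} (hk : n < k) :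
    z.charpoly.coeff k = 0 := by
  nontriviality R
  apply Polynomial.coeff_eq_zero_of_natDegree_lt
  rwa [z.charpoly_natDegree_eq_dim, Fintype.card_fin]

theorem bezoutKronecker_mul_kronecker_one (z : Matrix (Fin n) (Fin n) R) :
    bezoutKronecker z * (z ⊗ₖ 1) = bezoutKronecker z * (1 ⊗ₖ z) := by
  have hl : bezoutKronecker z * (z ⊗ₖ 1) =
      ∑ i ∈ range (n + 1), ∑ j ∈ range (n + 1),
        z.charpoly.coeff (i + j) • ((z ^ i) ⊗ₖ (z ^ j)) := by
    have h0 : ∑ j ∈ range (n + 1),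
        z.charpoly.coeff (0 + j) • ((z ^ 0) ⊗ₖ (z ^ j)) = 0 := by
      have h := congrArg (fun M => (1 : Matrix (Fin n) (Fin n) R) ⊗ₖ M)
        (sum_charpoly_coeff_smul_pow z)
      ext ⟨a, b⟩ ⟨c, d⟩
      have h' := congrFun (congrFun h (a, b)) (c, d)
      simp only [kroneckerMap_apply, Matrix.sum_apply, Matrix.smul_apply, smul_eq_mul,
        Matrix.zero_apply, mul_zero, Finset.mul_sum] at h'
      simp only [kroneckerMap_apply, Matrix.sum_apply, Matrix.smul_apply, smul_eq_mul,
        Matrix.zero_apply, pow_zero, zero_add]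
      rw [← h']
      exact Finset.sum_congr rfl fun _ _ => by ring
    rw [Finset.sum_range_succ', h0, add_zero, bezoutKronecker, Finset.sum_mul]
    refine Finset.sum_congr rfl fun i _ => ?_
    rw [Finset.sum_range_succ, charpoly_coeff_eq_zero z (by lia), zero_smul, add_zero,
      Finset.sum_mul]
    refine Finset.sum_congr rfl fun j _ => ?_
    rw [smul_mul_assoc, ← mul_kronecker_mul, mul_one, ← pow_succ,
      show i + j + 1 = i + 1 + j by ring]
  have hr : bezoutKronecker z * (1 ⊗ₖ z) =
      ∑ i ∈ range (n + 1), ∑ j ∈ range (n + 1),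
        z.charpoly.coeff (i + j) • ((z ^ i) ⊗ₖ (z ^ j)) := by
    have h0 : ∑ i ∈ range (n + 1),
        z.charpoly.coeff (i + 0) • ((z ^ i) ⊗ₖ (z ^ 0)) = 0 := by
      have h := congrArg (fun M => M ⊗ₖ (1 : Matrix (Fin n) (Fin n) R))
        (sum_charpoly_coeff_smul_pow z)
      ext ⟨a, b⟩ ⟨c, d⟩
      have h' := congrFun (congrFun h (a, b)) (c, d)
      simp only [kroneckerMap_apply, Matrix.sum_apply, Matrix.smul_apply, smul_eq_mul,
        Matrix.zero_apply, zero_mul, Finset.sum_mul] at h'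
      simp only [kroneckerMap_apply, Matrix.sum_apply, Matrix.smul_apply, smul_eq_mul,
        Matrix.zero_apply, pow_zero, add_zero]
      rw [← h']
      exact Finset.sum_congr rfl fun _ _ => by ring
    rw [Finset.sum_comm, Finset.sum_range_succ', h0, add_zero, bezoutKronecker, Finset.sum_comm,
      Finset.sum_mul]
    refine Finset.sum_congr rfl fun j _ => ?_
    rw [Finset.sum_range_succ, charpoly_coeff_eq_zero z (by lia), zero_smul, add_zero,
      Finset.sum_mul]
    refine Finset.sum_congr rfl fun i _ => ?_
    rw [smul_mul_assoc, ← mul_kronecker_mul, mul_one, ← pow_succ,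
      show i + j + 1 = i + (j + 1) by ring]
  rw [hl, hr]

theorem bezoutKronecker_mul_kronecker_pow (z : Matrix (Fin n) (Fin n) R) (k l : ℕ) :
    bezoutKronecker z * ((z ^ k) ⊗ₖ (z ^ l)) = bezoutKronecker z * (1 ⊗ₖ (z ^ (k + l))) := by
  induction k generalizing l with
  | zero => simp
  | succ k ih =>
    have h : (z ^ (k + 1)) ⊗ₖ (z ^ l) = (z ⊗ₖ (1 : Matrix (Fin n) (Fin n) R)) * ((z ^ k) ⊗ₖ (z ^ l)) := by
      rw [← mul_kronecker_mul, one_mul, ← pow_succ']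
    rw [h, ← Matrix.mul_assoc, bezoutKronecker_mul_kronecker_one, Matrix.mul_assoc,
      ← mul_kronecker_mul, one_mul, ← pow_succ', ih, show k + (l + 1) = k + 1 + l by ring]

theorem bezoutKronecker_submatrix_swap_swap (z : Matrix (Fin n) (Fin n) R) :
    (bezoutKronecker z).submatrix Prod.swap Prod.swap = bezoutKronecker z := by
  ext ⟨a, b⟩ ⟨c, d⟩
  simp only [bezoutKronecker, submatrix_apply, Prod.swap_prod_mk, Matrix.sum_apply,
    Matrix.smul_apply, kroneckerMap_apply, smul_eq_mul]
  rw [Finset.sum_comm]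
  refine Finset.sum_congr rfl fun i _ => Finset.sum_congr rfl fun j _ => ?_
  rw [add_comm j i, mul_comm ((z ^ j) b d)]

/-- The matrix with columns `e_q, z e_q, z² e_q, …`. -/
def krylov (z : Matrix (Fin n) (Fin n) R) (q : Fin n) : Matrix (Fin n) (Fin n) R :=
  Matrix.of fun p k => (z ^ (k : ℕ)) p q

theorem bezoutKronecker_mul_krylov_apply (z : Matrix (Fin n) (Fin n) R) (q : Fin n)
    (x : Fin n × Fin n) (k l : Fin n) :
    (bezoutKronecker z * (krylov z q ⊗ₖ krylov z q)) x (k, l) =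
      (bezoutKronecker z * ((z ^ (k : ℕ)) ⊗ₖ (z ^ (l : ℕ)))) x (q, q) := by
  simp [Matrix.mul_apply, krylov]

/-- If `z` has a cyclic basis vector, its Bézoutian vanishes on antisymmetric tensors. -/
theorem bezoutKronecker_submatrix_id_swap [IsDomain R] (z : Matrix (Fin n) (Fin n) R) (q : Fin n)
    (hz : (krylov z q).det ≠ 0) :
    (bezoutKronecker z).submatrix id Prod.swap = bezoutKronecker z := by
  set W := krylov z q with hW
  have hsymm : (bezoutKronecker z * (W ⊗ₖ W)).submatrix id Prod.swap =
      bezoutKronecker z * (W ⊗ₖ W) := by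
    ext x ⟨k, l⟩
    rw [submatrix_apply, id, Prod.swap_prod_mk, bezoutKronecker_mul_krylov_apply,
      bezoutKronecker_mul_krylov_apply, bezoutKronecker_mul_kronecker_pow,
      bezoutKronecker_mul_kronecker_pow, add_comm]
  have hcancel : bezoutKronecker z * (W ⊗ₖ W) * (W.adjugate ⊗ₖ W.adjugate) =
      (W.det * W.det) • bezoutKronecker z := by
    rw [Matrix.mul_assoc, ← mul_kronecker_mul, mul_adjugate, smul_kronecker, kronecker_smul,
      one_kronecker_one, smul_smul, mul_smul_comm, mul_one]
  have hswap : (W.adjugate ⊗ₖ W.adjugate).submatrix Prod.swap Prod.swap =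
      W.adjugate ⊗ₖ W.adjugate := by
    ext ⟨a, b⟩ ⟨c, d⟩
    simp [mul_comm]
  have hmul : ((bezoutKronecker z * (W ⊗ₖ W)) * (W.adjugate ⊗ₖ W.adjugate)).submatrix
      id Prod.swap = (bezoutKronecker z * (W ⊗ₖ W)) * (W.adjugate ⊗ₖ W.adjugate) := by
    conv_rhs => rw [← hsymm, ← hswap]
    exact (submatrix_mul_equiv _ _ id (Equiv.prodComm (Fin n) (Fin n)) Prod.swap).symm
  rw [hcancel] at hmul
  ext x y
  have h := congrFun (congrFun hmul x) y
  simp only [submatrix_apply, Matrix.smul_apply, smul_eq_mul] at h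
  exact mul_left_cancel₀ (mul_ne_zero hz hz) h

theorem bezoutKronecker_mul_kronecker_comm (z y a b : Matrix (Fin n) (Fin n) R)
    (hz : (bezoutKronecker z).submatrix id Prod.swap = bezoutKronecker z)
    (hy : (bezoutKronecker y).submatrix id Prod.swap = bezoutKronecker y) :
    bezoutKronecker z * (a ⊗ₖ b) * bezoutKronecker y =
      bezoutKronecker z * (b ⊗ₖ a) * bezoutKronecker y := by
  have hy' : (bezoutKronecker y).submatrix Prod.swap id = bezoutKronecker y := by
    conv_lhs => rw [← hy]
    exact bezoutKronecker_submatrix_swap_swap y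
  have hab : (a ⊗ₖ b).submatrix Prod.swap Prod.swap = b ⊗ₖ a := by
    ext ⟨i, j⟩ ⟨k, l⟩
    simp [mul_comm]
  have h1 := submatrix_mul_equiv (bezoutKronecker z) (a ⊗ₖ b) id
    (Equiv.prodComm (Fin n) (Fin n)) Prod.swap
  have h2 := submatrix_mul_equiv (bezoutKronecker z * (a ⊗ₖ b)) (bezoutKronecker y) id
    (Equiv.prodComm (Fin n) (Fin n)) id
  simp only [Equiv.coe_prodComm, hz, hab] at h1
  simp only [Equiv.coe_prodComm, hy', submatrix_id_id] at h2
  rw [← h2, ← h1]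

theorem bezoutKronecker_mul_kronecker_mul (z y a b : Matrix (Fin n) (Fin n) R) :
    bezoutKronecker z * (a ⊗ₖ b) * bezoutKronecker y =
      ∑ i ∈ range n, ∑ j ∈ range n, ∑ k ∈ range n, ∑ l ∈ range n,
        (z.charpoly.coeff (i + j + 1) * y.charpoly.coeff (k + l + 1)) •
          ((z ^ i * a * y ^ k) ⊗ₖ (z ^ j * b * y ^ l)) := by
  simp only [bezoutKronecker, Finset.sum_mul, smul_mul_assoc, ← mul_kronecker_mul]
  refine Finset.sum_congr rfl fun i _ => Finset.sum_congr rfl fun j _ => ?_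
  simp only [Finset.mul_sum, Finset.smul_sum, mul_smul_comm, smul_smul, ← mul_kronecker_mul]

end Bezout

section Substitution

variable {F : Type*} [Field F] {n : ℕ}

/-- The action of a substitution endomorphism on the coefficients. -/
noncomputable def substCoeff (φ : QPoly F n →ₐ[F] QPoly F n) : CPoly F n →ₐ[F] CPoly F n :=
  MvPolynomial.aeval fun p => PhiQ F n (φ (FreeAlgebra.ι (CPoly F n) p.2.2)) p.1 p.2.1

theorem PhiQ_ι (k : ℕ) : PhiQ F n (FreeAlgebra.ι (CPoly F n) k) = genMat F n k := by
  simp [PhiQ]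

theorem IsSubstEndo.apply_algebraMap {φ : QPoly F n →ₐ[F] QPoly F n} (hφ : IsSubstEndo F n φ)
    (c : CPoly F n) :
    φ (algebraMap (CPoly F n) (QPoly F n) c) =
      algebraMap (CPoly F n) (QPoly F n) (substCoeff φ c) := by
  have h : φ.comp (IsScalarTower.toAlgHom F (CPoly F n) (QPoly F n)) =
      (IsScalarTower.toAlgHom F (CPoly F n) (QPoly F n)).comp (substCoeff φ) := by
    apply MvPolynomial.algHom_ext
    rintro ⟨i, j, k⟩
    simpa [substCoeff] using hφ i j k
  exact DFunLike.congr_fun h c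

theorem IsSubstEndo.PhiQ_apply {φ : QPoly F n →ₐ[F] QPoly F n} (hφ : IsSubstEndo F n φ)
    (p : QPoly F n) : PhiQ F n (φ p) = (substCoeff φ).mapMatrix (PhiQ F n p) := by
  induction p using FreeAlgebra.induction with
  | grade0 r =>
    rw [hφ.apply_algebraMap, AlgHom.commutes, AlgHom.commutes, Matrix.algebraMap_eq_diagonal,
      Matrix.algebraMap_eq_diagonal]
    ext i j
    by_cases h : i = j <;> simp [Matrix.diagonal, h]
  | grade1 k =>
    rw [PhiQ_ι]
    ext i j
    simp [genMat, substCoeff]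
  | mul a b ha hb => rw [map_mul, map_mul, map_mul, map_mul, ha, hb]
  | add a b ha hb => rw [map_add, map_add, map_add, map_add, ha, hb]

theorem IsSubstEndo.comp {φ ψ : QPoly F n →ₐ[F] QPoly F n} (hφ : IsSubstEndo F n φ)
    (hψ : IsSubstEndo F n ψ) : IsSubstEndo F n (φ.comp ψ) := by
  intro i j k
  rw [AlgHom.comp_apply, AlgHom.comp_apply, hψ i j k, hφ.apply_algebraMap, hφ.PhiQ_apply]
  rfl

theorem isSubstEndo_id : IsSubstEndo F n (AlgHom.id F (QPoly F n)) := by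
  intro i j k
  simp [PhiQ_ι, genMat]

theorem evalQ_apply (A : ℕ → Matrix (Fin n) (Fin n) F) (p : QPoly F n) :
    evalQ F n A p = (evalC F n A).mapMatrix (PhiQ F n p) := rfl

theorem IsSubstEndo.evalQ_apply {φ : QPoly F n →ₐ[F] QPoly F n} (hφ : IsSubstEndo F n φ)
    (A : ℕ → Matrix (Fin n) (Fin n) F) (p : QPoly F n) :
    evalQ F n A (φ p) =
      evalQ F n (fun k => evalQ F n A (φ (FreeAlgebra.ι (CPoly F n) k))) p := by
  have h : (evalC F n A).comp (substCoeff φ) =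
      evalC F n fun k => evalQ F n A (φ (FreeAlgebra.ι (CPoly F n) k)) := by
    apply MvPolynomial.algHom_ext
    rintro ⟨i, j, k⟩
    simp [substCoeff, evalC, evalQ]
  rw [_root_.evalQ_apply, _root_.evalQ_apply, hφ.PhiQ_apply, ← h]
  rfl

theorem isTIdeal_isQuasiIdentity : IsTIdeal F n {P | IsQuasiIdentity F n P} := by
  refine ⟨fun A => map_zero _, fun a b ha hb A => ?_, fun r a ha A => ?_, fun r a ha A => ?_,
    fun φ hφ p hp A => ?_⟩
  · rw [map_add, ha A, hb A, add_zero]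
  · rw [map_mul, ha A, mul_zero]
  · rw [map_mul, ha A, zero_mul]
  · rw [hφ.evalQ_apply]
    exact hp _

theorem isQuasiIdentity_of_PhiQ_eq_zero {P : QPoly F n} (hP : PhiQ F n P = 0) :
    IsQuasiIdentity F n P := fun A => by
  rw [evalQ_apply, hP, map_zero]

theorem PhiQ_chQ : PhiQ F n (chQ F n) = 0 := by
  simp only [chQ, map_sum, map_mul, map_pow, AlgHom.commutes, PhiQ_ι]
  simpa only [Algebra.smul_def] using sum_charpoly_coeff_smul_pow (genMat F n 0)

/-- The ring homomorphism out of `C⟨X⟩` with prescribed values on `C` and on `X`. -/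
noncomputable def liftQ {A : Type*} [CommRing A] (θ : CPoly F n →+* A) (s : ℕ → A) :
    QPoly F n →+* A :=
  letI := θ.toAlgebra
  (FreeAlgebra.lift (CPoly F n) s).toRingHom

theorem liftQ_algebraMap {A : Type*} [CommRing A] (θ : CPoly F n →+* A) (s : ℕ → A)
    (c : CPoly F n) : liftQ θ s (algebraMap (CPoly F n) (QPoly F n) c) = θ c := by
  let := θ.toAlgebra
  exact (FreeAlgebra.lift (CPoly F n) s).commutes c

theorem liftQ_ι {A : Type*} [CommRing A] (θ : CPoly F n →+* A) (s : ℕ → A) (k : ℕ) :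
    liftQ θ s (FreeAlgebra.ι (CPoly F n) k) = s k := by
  let := θ.toAlgebra
  exact FreeAlgebra.lift_ι_apply s k

theorem TIdealSpan_subset_ker {A : Type*} [CommRing A] (Ψ : QPoly F n →+* A)
    {S : Set (QPoly F n)}
    (hS : ∀ p ∈ S, ∀ φ : QPoly F n →ₐ[F] QPoly F n, IsSubstEndo F n φ → Ψ (φ p) = 0) :
    ∀ p ∈ TIdealSpan F n S, Ψ p = 0 := by
  intro p hp
  refine hp {q | ∀ φ : QPoly F n →ₐ[F] QPoly F n, IsSubstEndo F n φ → Ψ (φ q) = 0}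
    ⟨⟨fun φ _ => by simp, fun a b ha hb φ hφ => ?_, fun r a ha φ hφ => ?_, fun r a ha φ hφ => ?_,
      fun ψ hψ q hq φ hφ => hq _ (hφ.comp hψ)⟩, hS⟩ _ isSubstEndo_id
  · rw [map_add, map_add, ha φ hφ, hb φ hφ, add_zero]
  · rw [map_mul, map_mul, ha φ hφ, mul_zero]
  · rw [map_mul, map_mul, ha φ hφ, zero_mul]

theorem liftQ_chQ {A : Type*} [CommRing A] (θ : CPoly F n →+* A) (s : ℕ → A)
    {φ : QPoly F n →ₐ[F] QPoly F n} (hφ : IsSubstEndo F n φ) :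
    liftQ θ s (φ (chQ F n)) =
      (θ.mapMatrix (PhiQ F n (φ (FreeAlgebra.ι (CPoly F n) 0)))).charpoly.eval
        (liftQ θ s (φ (FreeAlgebra.ι (CPoly F n) 0))) := by
  nontriviality A
  rw [Polynomial.eval_eq_sum_range, Matrix.charpoly_natDegree_eq_dim, Fintype.card_fin, chQ]
  simp only [map_sum, map_mul, map_pow, hφ.apply_algebraMap, liftQ_algebraMap, hφ.PhiQ_apply,
    PhiQ_ι, RingHom.mapMatrix_apply, Matrix.charpoly_map, Polynomial.coeff_map]
  refine Finset.sum_congr rfl fun i _ => ?_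
  congr 2
  rw [AlgHom.mapMatrix_apply]
  have h := Matrix.charpoly_map (genMat F n 0) (substCoeff φ).toRingHom
  have h' : (genMat F n 0).map (substCoeff φ) = (genMat F n 0).map (substCoeff φ).toRingHom := rfl
  rw [h', h, Polynomial.coeff_map]
  rfl

end Substitution

section Detection

open Matrix

variable {A : Type*} [CommRing A] {m : ℕ}

/-- The diagonal matrix `diag(a, -a, -1, …, -1)`. -/
def diagPair (m : ℕ) (a : A) : Matrix (Fin (m + 2)) (Fin (m + 2)) A :=
  diagonal (Fin.cons a (Fin.cons (-a) fun _ => -1))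

/-- The matrices substituted for `x_0, x_1, x_2, …`. -/
def detectMat (m : ℕ) (a : A) : ℕ → Matrix (Fin (m + 2)) (Fin (m + 2)) A
  | 0 => diagPair m a
  | 1 => diagPair m 0 + single 0 1 1
  | _ => 0

/-- The scalars substituted for the letters `x_0, x_1, x_2, …`. -/
def detectLetter (e : A) : ℕ → A
  | 2 => e
  | _ => 0

theorem diag_mul_of_blockTriangular {M N : Matrix (Fin m) (Fin m) A} (hM : M.BlockTriangular id)
    (hN : N.BlockTriangular id) (i : Fin m) : (M * N) i i = M i i * N i i := by
  rw [mul_apply]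
  refine Finset.sum_eq_single i (fun j _ hj => ?_) (by simp)
  rcases lt_or_gt_of_ne hj with h | h
  · rw [hM h, zero_mul]
  · rw [hN h, mul_zero]

theorem blockTriangular_detectMat (a : A) (k : ℕ) : (detectMat m a k).BlockTriangular id := by
  match k with
  | 0 => exact blockTriangular_diagonal _
  | 1 =>
    refine (blockTriangular_diagonal _).add fun i j hij => ?_
    rw [single_apply_of_ne]
    rintro ⟨rfl, rfl⟩
    simp at hij
  | k + 2 => exact blockTriangular_zero

theorem charpoly_detectMat_zero {a : A} (ha : a * a = 0) :
    (detectMat m a 0).charpoly =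
      Polynomial.X * (Polynomial.X * (Polynomial.X + 1) ^ m) := by
  have ha' : (Polynomial.C a) * Polynomial.C a = 0 := by rw [← Polynomial.C_mul, ha, map_zero]
  rw [charpoly_of_isUpperTriangular _ (blockTriangular_detectMat a 0), Fin.prod_univ_succ,
    Fin.prod_univ_succ]
  simp [detectMat, diagPair]
  linear_combination (-(Polynomial.X + 1) ^ m) * ha'

theorem charpoly_detectMat_one (a : A) :
    (detectMat m a 1).charpoly =
      Polynomial.X * (Polynomial.X * (Polynomial.X + 1) ^ m) := by
  rw [charpoly_of_isUpperTriangular _ (blockTriangular_detectMat a 1), Fin.prod_univ_succ,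
    Fin.prod_univ_succ]
  have h : ∀ x : Fin m, (single (0 : Fin (m + 2)) 1 (1 : A)) x.succ.succ x.succ.succ = 0 :=
    fun x => single_apply_of_ne _ _ _ _ _ (by simp [Fin.ext_iff])
  simp [detectMat, diagPair, h]

theorem sum_coeff_smul_pow_of_charpoly {z : Matrix (Fin (m + 2)) (Fin (m + 2)) A}
    (hz : z.charpoly = Polynomial.X * (Polynomial.X * (Polynomial.X + 1) ^ m)) :
    ∑ i ∈ Finset.range (m + 2), z.charpoly.coeff (i + 1) • z ^ i = z * (z + 1) ^ m := by
  nontriviality A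
  have hdeg : (Polynomial.X * (Polynomial.X + 1) ^ m : Polynomial A).natDegree < m + 2 := by
    have : (Polynomial.X * (Polynomial.X + 1) ^ m : Polynomial A).natDegree ≤ 1 + m * 1 :=
      Polynomial.natDegree_mul_le_of_le Polynomial.natDegree_X_le
        (Polynomial.natDegree_pow_le_of_le _ (by simpa using (Polynomial.natDegree_X_add_C (1 : A)).le))
    lia
  have h : Polynomial.aeval z (Polynomial.X * (Polynomial.X + 1) ^ m : Polynomial A) =
      z * (z + 1) ^ m := by simp
  rw [← h, Polynomial.aeval_eq_sum_range' hdeg]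
  refine Finset.sum_congr rfl fun i _ => ?_
  rw [hz, Polynomial.coeff_X_mul]

theorem mul_one_add_pow_of_mul_self {a : A} (ha : a * a = 0) (k : ℕ) : a * (a + 1) ^ k = a := by
  induction k with
  | zero => simp
  | succ k ih => rw [pow_succ, ← mul_assoc, ih, mul_add, ha, zero_add, mul_one]

theorem row_mul_add_one_pow {k : ℕ} {N : Matrix (Fin k) (Fin k) A} {v : Fin k → A} {c : A}
    (h : v ᵥ* N = c • v) (r : ℕ) : v ᵥ* (N + 1) ^ r = (c + 1) ^ r • v := by
  induction r with
  | zero => simp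
  | succ r ih =>
    rw [pow_succ, ← vecMul_vecMul, ih, smul_vecMul, vecMul_add, h, vecMul_one, pow_succ, mul_smul,
      add_smul, one_smul]

theorem detectMat_entry {a : A} (ha : a * a = 0) :
    ((detectMat m a 0 * (detectMat m a 0 + 1) ^ m) *
      (detectMat m a 1 * (detectMat m a 1 + 1) ^ m)) 0 1 = a := by
  have h0 : Pi.single 0 1 ᵥ* detectMat m a 0 = a • (Pi.single 0 1 : Fin (m + 2) → A) := by
    ext j
    refine Fin.cases ?_ (fun j => ?_) j <;> simp [detectMat, diagPair]
  have h1 : Pi.single 0 1 ᵥ* detectMat m a 1 = (Pi.single 1 1 : Fin (m + 2) → A) := by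
    ext j
    simp [detectMat, diagPair, diagonal_apply, single_apply, Pi.single_apply, eq_comm]
  have h2 : Pi.single 1 1 ᵥ* detectMat m a 1 = (0 : A) • (Pi.single 1 1 : Fin (m + 2) → A) := by
    ext j
    simp [detectMat, diagPair, diagonal_apply]
  have h : Pi.single 0 1 ᵥ* ((detectMat m a 0 * (detectMat m a 0 + 1) ^ m) *
      (detectMat m a 1 * (detectMat m a 1 + 1) ^ m)) = a • (Pi.single 1 1 : Fin (m + 2) → A) := by
    rw [← vecMul_vecMul, ← vecMul_vecMul (M := detectMat m a 0), h0, smul_vecMul,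
      row_mul_add_one_pow h0, smul_smul, mul_one_add_pow_of_mul_self ha, smul_vecMul,
      ← vecMul_vecMul, h1, row_mul_add_one_pow h2]
    simp
  have := congrFun h 1
  simpa using this

end Detection

section Counterexample

open Matrix Finset
open scoped Kronecker

variable (F : Type*) [Field F] (m : ℕ)

/-- A quasi-identity expressing that the Bézoutians of two generic matrices intertwine
`1 ⊗ x_2` and `x_2 ⊗ 1`. -/
noncomputable def bezoutQ : QPoly F (m + 2) :=
  ∑ i ∈ range (m + 2), ∑ j ∈ range (m + 2), ∑ k ∈ range (m + 2), ∑ l ∈ range (m + 2),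
    algebraMap (CPoly F (m + 2)) (QPoly F (m + 2))
        ((genMat F (m + 2) 0).charpoly.coeff (i + j + 1) *
          (genMat F (m + 2) 1).charpoly.coeff (k + l + 1)) *
      (algebraMap (CPoly F (m + 2)) (QPoly F (m + 2))
          ((genMat F (m + 2) 0 ^ i * genMat F (m + 2) 1 ^ k : Matrix _ _ _) 0 1) *
          (FreeAlgebra.ι (CPoly F (m + 2)) 0 ^ j * FreeAlgebra.ι (CPoly F (m + 2)) 2 *
            FreeAlgebra.ι (CPoly F (m + 2)) 1 ^ l) -
        algebraMap (CPoly F (m + 2)) (QPoly F (m + 2))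
          ((genMat F (m + 2) 0 ^ i * genMat F (m + 2) 2 * genMat F (m + 2) 1 ^ k : Matrix _ _ _) 0 1) *
          (FreeAlgebra.ι (CPoly F (m + 2)) 0 ^ j * FreeAlgebra.ι (CPoly F (m + 2)) 1 ^ l))

theorem det_krylov_shift_ne_zero :
    (krylov (Matrix.of fun i j : Fin (m + 2) => if (i : ℕ) = j + 1 then (1 : F) else 0) 0).det
      ≠ 0 := by
  set z : Matrix (Fin (m + 2)) (Fin (m + 2)) F :=
    Matrix.of fun i j => if (i : ℕ) = j + 1 then (1 : F) else 0 with hz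
  have h : ∀ k < m + 2, ∀ p : Fin (m + 2), (z ^ k) p 0 = if (p : ℕ) = k then 1 else 0 := by
    intro k
    induction k with
    | zero =>
      intro _ p
      rw [pow_zero, Matrix.one_apply]
      exact if_congr Fin.ext_iff rfl rfl
    | succ k ih =>
      intro hk p
      rw [pow_succ', mul_apply, Finset.sum_eq_single (⟨k, by lia⟩ : Fin (m + 2))]
      · rw [ih (by lia)]
        simp [hz]
      · intro j _ hj
        rw [ih (by lia), if_neg (by simpa [Fin.ext_iff] using hj), mul_zero]
      · simp
  have h1 : krylov z 0 = 1 := by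
    ext p k
    simp only [krylov, of_apply, h k k.2 p, one_apply, Fin.ext_iff]
  rw [h1, det_one]
  exact one_ne_zero

theorem det_krylov_genMat_ne_zero (k : ℕ) : (krylov (genMat F (m + 2) k) 0).det ≠ 0 := by
  intro h
  let S : Matrix (Fin (m + 2)) (Fin (m + 2)) F :=
    Matrix.of fun i j => if (i : ℕ) = j + 1 then (1 : F) else 0
  let f := evalC F (m + 2) fun _ => S
  have hS : f.mapMatrix (genMat F (m + 2) k) = S := by
    ext i j
    simp [genMat, f, evalC]
  have hK : f.mapMatrix (krylov (genMat F (m + 2) k) 0) = krylov S 0 := by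
    ext i j
    have := congrFun (congrFun (map_pow f.mapMatrix (genMat F (m + 2) k) j) i) 0
    rw [hS] at this
    simpa [krylov] using this
  have h' := f.map_det (krylov (genMat F (m + 2) k) 0)
  rw [h, map_zero, hK] at h'
  exact det_krylov_shift_ne_zero F m h'.symm

theorem PhiQ_bezoutQ : PhiQ F (m + 2) (bezoutQ F m) = 0 := by
  have h := bezoutKronecker_mul_kronecker_comm (genMat F (m + 2) 0) (genMat F (m + 2) 1) 1
    (genMat F (m + 2) 2)
    (bezoutKronecker_submatrix_id_swap _ 0 (det_krylov_genMat_ne_zero F m 0))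
    (bezoutKronecker_submatrix_id_swap _ 0 (det_krylov_genMat_ne_zero F m 1))
  rw [bezoutKronecker_mul_kronecker_mul, bezoutKronecker_mul_kronecker_mul] at h
  refine Matrix.ext fun p q => ?_
  have h' := sub_eq_zero.mpr (congrFun (congrFun h (0, p)) (1, q))
  rw [Matrix.zero_apply, ← h']
  simp only [bezoutQ, ← Algebra.smul_def]
  simp only [map_sum, map_smul, map_sub, map_mul, map_pow, PhiQ_ι, mul_one, Matrix.sum_apply,
    Matrix.smul_apply, Matrix.sub_apply, kroneckerMap_apply, smul_eq_mul,
    ← Finset.sum_sub_distrib, mul_sub]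

variable {F m} {A : Type*} [CommRing A] [Algebra F A]

/-- Evaluation of `C` at the matrices `detectMat m a`. -/
noncomputable def detectC (F : Type*) [Field F] {A : Type*} [CommRing A] [Algebra F A] (m : ℕ)
    (a : A) : CPoly F (m + 2) →ₐ[F] A :=
  MvPolynomial.aeval fun p => detectMat m a p.2.2 p.1 p.2.1

theorem detectC_genMat (a : A) (k : ℕ) :
    (genMat F (m + 2) k).map (detectC F m a) = detectMat m a k := by
  ext i j
  simp [genMat, detectC]

theorem detect_invariant {a e : A} (ha : a * a = 0) (he : e * e = 0) (p : QPoly F (m + 2)) :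
    ((PhiQ F (m + 2) p).map (detectC F m a)).BlockTriangular id ∧
      ∃ c u v : A, liftQ (detectC F m a).toRingHom (detectLetter e) p = c + u * e ∧
        (PhiQ F (m + 2) p).map (detectC F m a) 0 0 = c + v * a ∧
        (PhiQ F (m + 2) p).map (detectC F m a) 1 1 = c - v * a := by
  induction p using FreeAlgebra.induction with
  | grade0 r =>
    rw [AlgHom.commutes, Matrix.algebraMap_eq_diagonal, diagonal_map (map_zero _)]
    exact ⟨blockTriangular_diagonal _, detectC F m a r, 0, 0, by simp [liftQ_algebraMap]⟩
  | grade1 k =>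
    rw [PhiQ_ι, detectC_genMat]
    refine ⟨blockTriangular_detectMat a k, ?_⟩
    simp only [liftQ_ι]
    match k with
    | 0 => exact ⟨0, 0, 1, by simp [detectLetter, detectMat, diagPair]⟩
    | 1 => exact ⟨0, 0, 0, by simp [detectLetter, detectMat, diagPair]⟩
    | 2 => exact ⟨0, 1, 0, by simp [detectLetter, detectMat]⟩
    | k + 3 => exact ⟨0, 0, 0, by simp [detectLetter, detectMat]⟩
  | mul x y hx hy =>
    obtain ⟨tx, c, u, v, h1, h2, h3⟩ := hx
    obtain ⟨ty, c', u', v', h1', h2', h3'⟩ := hy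
    rw [map_mul, Matrix.map_mul, map_mul]
    refine ⟨tx.mul ty, c * c', c * u' + u * c', c * v' + v * c', ?_, ?_, ?_⟩
    · rw [h1, h1']
      linear_combination u * u' * he
    · rw [diag_mul_of_blockTriangular tx ty, h2, h2']
      linear_combination v * v' * ha
    · rw [diag_mul_of_blockTriangular tx ty, h3, h3']
      linear_combination v * v' * ha
  | add x y hx hy =>
    obtain ⟨tx, c, u, v, h1, h2, h3⟩ := hx
    obtain ⟨ty, c', u', v', h1', h2', h3'⟩ := hy
    rw [map_add, Matrix.map_add _ (map_add _), map_add]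
    refine ⟨tx.add ty, c + c', u + u', v + v', ?_, ?_, ?_⟩
    · rw [h1, h1']
      ring
    · rw [Matrix.add_apply, h2, h2']
      ring
    · rw [Matrix.add_apply, h3, h3']
      ring

theorem liftQ_detect_chQ {a e : A} (ha : a * a = 0) (he : e * e = 0)
    {φ : QPoly F (m + 2) →ₐ[F] QPoly F (m + 2)} (hφ : IsSubstEndo F (m + 2) φ) :
    liftQ (detectC F m a).toRingHom (detectLetter e) (φ (chQ F (m + 2))) = 0 := by
  rw [liftQ_chQ _ _ hφ]
  obtain ⟨ht, c, u, v, h1, h2, h3⟩ :=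
    detect_invariant ha he (φ (FreeAlgebra.ι (CPoly F (m + 2)) 0))
  change Polynomial.eval _ ((PhiQ F (m + 2) _).map (detectC F m a)).charpoly = 0
  rw [charpoly_of_isUpperTriangular _ ht, Fin.prod_univ_succ, Fin.prod_univ_succ, Fin.succ_zero_eq_one,
    h1, h2, h3, ← mul_assoc, Polynomial.eval_mul]
  have h : (Polynomial.eval (c + u * e) ((Polynomial.X - Polynomial.C (c + v * a)) *
      (Polynomial.X - Polynomial.C (c - v * a)))) = 0 := by
    simp only [Polynomial.eval_mul, Polynomial.eval_sub, Polynomial.eval_X, Polynomial.eval_C]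
    linear_combination u * u * he - v * v * ha
  rw [h, zero_mul]

theorem liftQ_detect_bezoutQ {a e : A} (ha : a * a = 0) :
    liftQ (detectC F m a).toRingHom (detectLetter e) (bezoutQ F m) = a * e := by
  have hc : ∀ k r, detectC F m a ((genMat F (m + 2) k).charpoly.coeff r) =
      (detectMat m a k).charpoly.coeff r := by
    intro k r
    rw [← detectC_genMat (F := F)]
    exact (congrArg (Polynomial.coeff · r)
      (charpoly_map (genMat F (m + 2) k) (detectC F m a).toRingHom)).symm ▸
      (Polynomial.coeff_map _ _).symm
  have hpow : ∀ k i, (genMat F (m + 2) k ^ i).map (detectC F m a) = detectMat m a k ^ i := by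
    intro k i
    rw [← detectC_genMat (F := F)]
    exact map_pow (detectC F m a).mapMatrix _ _
  have h1 : ∀ i k : ℕ,
      detectC F m a ((genMat F (m + 2) 0 ^ i * genMat F (m + 2) 1 ^ k : Matrix _ _ _) 0 1) =
        (detectMat m a 0 ^ i * detectMat m a 1 ^ k) 0 1 := by
    intro i k
    rw [← hpow, ← hpow, ← Matrix.map_mul, map_apply]
  have h2 : ∀ i k : ℕ, detectC F m a
      ((genMat F (m + 2) 0 ^ i * genMat F (m + 2) 2 * genMat F (m + 2) 1 ^ k : Matrix _ _ _) 0 1)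
        = 0 := by
    intro i k
    rw [← map_apply (f := detectC F m a), Matrix.map_mul, Matrix.map_mul, detectC_genMat]
    simp [detectMat]
  have hsum : a * e = ∑ i ∈ range (m + 2), ∑ k ∈ range (m + 2),
      (detectMat m a 0).charpoly.coeff (i + 1) * (detectMat m a 1).charpoly.coeff (k + 1) *
        ((detectMat m a 0 ^ i * detectMat m a 1 ^ k) 0 1 * e) := by
    conv_lhs => rw [← detectMat_entry (m := m) ha,
      ← sum_coeff_smul_pow_of_charpoly (charpoly_detectMat_zero ha),
      ← sum_coeff_smul_pow_of_charpoly (charpoly_detectMat_one a)]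
    simp only [Finset.sum_mul, Finset.mul_sum, smul_mul_assoc, mul_smul_comm, Matrix.sum_apply,
      Matrix.smul_apply, smul_eq_mul]
    rw [Finset.sum_comm]
    exact Finset.sum_congr rfl fun i _ => Finset.sum_congr rfl fun k _ => by ring
  rw [hsum]
  simp only [bezoutQ, map_sum, map_mul, map_sub, map_pow, liftQ_algebraMap, liftQ_ι,
    AlgHom.toRingHom_eq_coe, RingHom.coe_coe, hc, h1, h2, zero_mul, sub_zero, detectLetter]
  refine Finset.sum_congr rfl fun i _ => ?_
  rw [Finset.sum_range_succ', Finset.sum_eq_zero fun j _ => by simp, zero_add]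
  refine Finset.sum_congr rfl fun k _ => ?_
  rw [Finset.sum_range_succ', Finset.sum_eq_zero fun l _ => by simp]
  simp

end Counterexample

theorem stmt1 (F : Type*) [Field F] [CharZero F] (n : ℕ) (hn : 2 ≤ n) :
    TIdealSpan F n {chQ F n} ⊂ {P : QPoly F n | IsQuasiIdentity F n P} := by
  obtain ⟨m, rfl⟩ : ∃ m, n = m + 2 := ⟨n - 2, by lia⟩
  refine ⟨fun p hp => hp _ ⟨isTIdeal_isQuasiIdentity, ?_⟩, fun h => ?_⟩
  · rw [Set.singleton_subset_iff]
    exact isQuasiIdentity_of_PhiQ_eq_zero PhiQ_chQ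
  · let a : DualNumber (DualNumber F) := TrivSqZeroExt.inl DualNumber.eps
    let e : DualNumber (DualNumber F) := DualNumber.eps
    have ha : a * a = 0 := by
      rw [← TrivSqZeroExt.inl_mul, DualNumber.eps_mul_eps, TrivSqZeroExt.inl_zero]
    have he : e * e = 0 := DualNumber.eps_mul_eps
    have hmem : bezoutQ F m ∈ TIdealSpan F (m + 2) {chQ F (m + 2)} :=
      h (isQuasiIdentity_of_PhiQ_eq_zero (PhiQ_bezoutQ F m))
    have h0 := TIdealSpan_subset_ker (liftQ (detectC F m a).toRingHom (detectLetter e))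
      (fun p hp φ hφ => by
        rw [Set.mem_singleton_iff.mp hp]
        exact liftQ_detect_chQ ha he hφ) _ hmem
    rw [liftQ_detect_bezoutQ ha] at h0
    have h1 := congrArg (fun x => TrivSqZeroExt.snd (TrivSqZeroExt.snd x)) h0
    simp [a, e] at h1
end

section
/- Every multilinear quasi-identity of M_n of degree n (in the variables x_1,…,x_n) is an F-scalar multiple of the multilinear Cayley–Hamilton polynomial Q_n. -/
open scoped TensorProduct

variable (F : Type*) [Field F] [CharZero F] (n : ℕ)

/-- A basic multilinear term of degree `n`:
`x_{s_1 t_1}^{(i_1)} ⋯ x_{s_k t_k}^{(i_k)} · x_{i_{k+1}} ⋯ x_{i_n}` where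
`(i_1, …, i_n)` is the permutation `σ` of the variables. -/
noncomputable def mlTerm (σ : Equiv.Perm (Fin n)) (k : ℕ) (s t : Fin n → Fin n) :
    QPoly F n :=
  algebraMap (CPoly F n) (QPoly F n)
      ((((List.finRange n).take k).map
        (fun j => MvPolynomial.X (s j, t j, (σ j : ℕ)))).prod) *
    (((List.finRange n).drop k).map
        (fun j => FreeAlgebra.ι (CPoly F n) (σ j : ℕ))).prod

/-- A quasi-polynomial is multilinear of degree `n` if it is an `F`-linear combination
of basic multilinear terms. -/
def IsMultilinearDegN (P : QPoly F n) : Prop :=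
  P ∈ Submodule.span F
    {p : QPoly F n | ∃ (σ : Equiv.Perm (Fin n)) (k : ℕ) (s t : Fin n → Fin n),
      k ≤ n ∧ p = mlTerm F n σ k s t}

/-- `σ_T(q_n)` : the Cayley–Hamilton polynomial with `x_1` replaced by `a` and the
generic matrix `ξ_1` replaced by `M`. -/
noncomputable def chQSubst (M : Matrix (Fin n) (Fin n) (CPoly F n)) (a : QPoly F n) :
    QPoly F n :=
  ∑ i ∈ Finset.range (n + 1),
    algebraMap (CPoly F n) (QPoly F n) (M.charpoly.coeff i) * a ^ i

/-- The multilinear Cayley–Hamilton polynomial `Q_n`, the full polarization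
`Q_n = Σ_{T ⊆ {1,…,n}} (−1)^{n−|T|} σ_T(q_n)`. -/
noncomputable def QnPol : QPoly F n :=
  ∑ T : Finset (Fin n), ((-1 : F) ^ (n - T.card)) •
    chQSubst F n (∑ k ∈ T, genMat F n (k : ℕ)) (∑ k ∈ T, FreeAlgebra.ι (CPoly F n) (k : ℕ))

section QuasiPolynomial

set_option linter.unusedSectionVars false

variable {F n}

variable (F n) in
/-- The monomial `x_{k_1} ⋯ x_{k_l}` of `C⟨X⟩` attached to a word. -/
noncomputable def wordMonomial (w : List ℕ) : QPoly F n :=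
  (w.map (FreeAlgebra.ι (CPoly F n))).prod

variable (F n) in
/-- The basis of `C⟨X⟩` over `C` given by words. -/
noncomputable def wordBasis :
    Module.Basis (List ℕ) (CPoly F n) (QPoly F n) :=
  (FreeAlgebra.basisFreeMonoid (CPoly F n) ℕ).reindex FreeMonoid.toList

theorem wordBasis_apply (w : List ℕ) : wordBasis F n w = wordMonomial F n w := by
  simp [wordBasis, FreeAlgebra.basisFreeMonoid, wordMonomial,
    FreeAlgebra.equivMonoidAlgebraFreeMonoid]

/-- The coefficient in `C` of a word in a quasi-polynomial. -/
noncomputable def wordCoeff (w : List ℕ) : QPoly F n →ₗ[CPoly F n] CPoly F n :=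
  (wordBasis F n).coord w

theorem wordCoeff_wordMonomial (w w' : List ℕ) :
    wordCoeff w (wordMonomial F n w') = if w' = w then 1 else 0 := by
  rw [← wordBasis_apply, wordCoeff, Module.Basis.coord_apply, Module.Basis.repr_self,
    Finsupp.single_apply]

theorem wordCoeff_algebraMap_mul (w : List ℕ) (c : CPoly F n) (P : QPoly F n) :
    wordCoeff w (algebraMap (CPoly F n) (QPoly F n) c * P) = c * wordCoeff w P := by
  rw [← Algebra.smul_def, map_smul, smul_eq_mul]

theorem wordCoeff_smul (w : List ℕ) (a : F) (P : QPoly F n) :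
    wordCoeff w (a • P) = a • wordCoeff w P := by
  rw [← algebraMap_smul (CPoly F n) a P, map_smul, algebraMap_smul]

theorem quasiPoly_ext {P Q : QPoly F n} (h : ∀ w, wordCoeff w P = wordCoeff w Q) : P = Q :=
  (wordBasis F n).ext_elem h

/-- The set of words occurring in a quasi-polynomial. -/
noncomputable def wordSupport (P : QPoly F n) : Finset (List ℕ) := ((wordBasis F n).repr P).support

theorem mem_wordSupport {P : QPoly F n} {w : List ℕ} :
    w ∈ wordSupport P ↔ wordCoeff w P ≠ 0 := by
  simp [wordSupport, wordCoeff]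

theorem sum_wordCoeff_mul (P : QPoly F n) :
    ∑ w ∈ wordSupport P, algebraMap (CPoly F n) (QPoly F n) (wordCoeff w P) * wordMonomial F n w
      = P := by
  conv_rhs => rw [← (wordBasis F n).linearCombination_repr P]
  simp [Finsupp.linearCombination_apply, Finsupp.sum, wordSupport, wordCoeff, wordBasis_apply,
    Algebra.smul_def]

theorem wordMonomial_append (u v : List ℕ) :
    wordMonomial F n (u ++ v) = wordMonomial F n u * wordMonomial F n v := by
  simp [wordMonomial]

theorem evalQ_algebraMap_mul (A : ℕ → Matrix (Fin n) (Fin n) F) (c : CPoly F n) (P : QPoly F n) :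
    evalQ F n A (algebraMap (CPoly F n) (QPoly F n) c * P) = evalC F n A c • evalQ F n A P := by
  rw [← Algebra.smul_def]
  ext i j
  simp [evalQ]

theorem evalQ_ι (A : ℕ → Matrix (Fin n) (Fin n) F) (k : ℕ) :
    evalQ F n A (FreeAlgebra.ι (CPoly F n) k) = A k := by
  ext i j
  simp [evalQ, PhiQ, genMat, evalC]

theorem evalQ_wordMonomial (A : ℕ → Matrix (Fin n) (Fin n) F) (w : List ℕ) :
    evalQ F n A (wordMonomial F n w) = (w.map A).prod := by
  rw [wordMonomial, map_list_prod, List.map_map]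
  congr 2
  funext k
  exact evalQ_ι A k

theorem evalQ_apply_eq_sum (A : ℕ → Matrix (Fin n) (Fin n) F) (P : QPoly F n) (i j : Fin n) :
    evalQ F n A P i j =
      ∑ w ∈ wordSupport P, evalC F n A (wordCoeff w P) * (w.map A).prod i j := by
  conv_lhs => rw [← sum_wordCoeff_mul P]
  simp [map_sum, evalQ_algebraMap_mul, evalQ_wordMonomial, Matrix.sum_apply]

/-- The multidegree of the term `ξ^m · w`, as the multiset of indices of the variables in it. -/
noncomputable def multidegree (m : Fin n × Fin n × ℕ →₀ ℕ) (w : List ℕ) : Multiset ℕ :=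
  (Finsupp.toMultiset m).map (fun p => p.2.2) + (w : Multiset ℕ)

theorem multidegree_add_append (m m' : Fin n × Fin n × ℕ →₀ ℕ) (w w' : List ℕ) :
    multidegree (m + m') (w ++ w') = multidegree m w + multidegree m' w' := by
  simp only [multidegree, map_add, Multiset.map_add, ← Multiset.coe_add]
  abel

variable (F n) in
/-- The quasi-polynomials all of whose terms have multidegree in a given set. -/
noncomputable def multidegreeIn (D : Set (Multiset ℕ)) :
    Submodule F (QPoly F n) where
  carrier := {P | ∀ w m, MvPolynomial.coeff m (wordCoeff w P) ≠ 0 → multidegree m w ∈ D}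
  zero_mem' := by simp
  add_mem' {P Q} hP hQ w m h := by
    rw [map_add, MvPolynomial.coeff_add] at h
    by_cases h' : MvPolynomial.coeff m (wordCoeff w P) = 0
    · exact hQ w m (by simpa [h'] using h)
    · exact hP w m h'
  smul_mem' a P hP w m h := by
    rw [wordCoeff_smul, MvPolynomial.coeff_smul] at h
    exact hP w m (right_ne_zero_of_smul h)

variable (F n) in
/-- The term `ξ^m · w` of `C⟨X⟩`. -/
noncomputable def quasiTerm (m : Fin n × Fin n × ℕ →₀ ℕ)
    (w : List ℕ) : QPoly F n :=
  algebraMap (CPoly F n) (QPoly F n) (MvPolynomial.monomial m 1) * wordMonomial F n w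

theorem quasiTerm_mul (m m' : Fin n × Fin n × ℕ →₀ ℕ) (w w' : List ℕ) :
    quasiTerm F n m w * quasiTerm F n m' w' = quasiTerm F n (m + m') (w ++ w') := by
  have h := Algebra.commutes (R := CPoly F n) (MvPolynomial.monomial m' (1 : F))
    (wordMonomial F n w)
  have h' : MvPolynomial.monomial (m + m') (1 : F) =
      MvPolynomial.monomial m 1 * MvPolynomial.monomial m' 1 := by
    rw [MvPolynomial.monomial_mul, one_mul]
  rw [quasiTerm, quasiTerm, quasiTerm, wordMonomial_append, mul_assoc,
    ← mul_assoc _ _ (wordMonomial F n w'), ← h, h', map_mul]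
  simp only [mul_assoc]

theorem coeff_wordCoeff_quasiTerm (m m' : Fin n × Fin n × ℕ →₀ ℕ) (w w' : List ℕ) :
    MvPolynomial.coeff m (wordCoeff w (quasiTerm F n m' w')) =
      if m' = m ∧ w' = w then 1 else 0 := by
  rw [quasiTerm, wordCoeff_algebraMap_mul, wordCoeff_wordMonomial]
  by_cases h : w' = w <;> simp [h, MvPolynomial.coeff_monomial]

theorem quasiTerm_mem_multidegreeIn {D : Set (Multiset ℕ)} {m : Fin n × Fin n × ℕ →₀ ℕ}
    {w : List ℕ} (h : multidegree m w ∈ D) : quasiTerm F n m w ∈ multidegreeIn F n D := by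
  intro w' m' h'
  rw [coeff_wordCoeff_quasiTerm] at h'
  obtain ⟨rfl, rfl⟩ : m = m' ∧ w = w' := by simpa using h'
  exact h

theorem multidegreeIn_eq_span (D : Set (Multiset ℕ)) :
    multidegreeIn F n D =
      Submodule.span F {P | ∃ m w, multidegree m w ∈ D ∧ P = quasiTerm F n m w} := by
  apply le_antisymm
  · intro P hP
    rw [← sum_wordCoeff_mul P]
    refine Submodule.sum_mem _ fun w _ => ?_
    conv in wordCoeff w P => rw [MvPolynomial.as_sum (wordCoeff w P)]
    rw [map_sum, Finset.sum_mul]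
    refine Submodule.sum_mem _ fun m hm => ?_
    have : algebraMap (CPoly F n) (QPoly F n)
        (MvPolynomial.monomial m (MvPolynomial.coeff m (wordCoeff w P))) * wordMonomial F n w
        = MvPolynomial.coeff m (wordCoeff w P) • quasiTerm F n m w := by
      rw [quasiTerm, ← smul_mul_assoc, ← algebraMap_smul (CPoly F n) (_ : F) (_ : QPoly F n),
        Algebra.smul_def, ← map_mul, MvPolynomial.algebraMap_eq, MvPolynomial.C_mul_monomial,
        mul_one]
    rw [this]
    exact Submodule.smul_mem _ _ (Submodule.subset_span ⟨m, w, hP w m (by simpa using hm), rfl⟩)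
  · rw [Submodule.span_le]
    rintro _ ⟨m, w, h, rfl⟩
    exact quasiTerm_mem_multidegreeIn h

theorem mul_mem_multidegreeIn {D D' E : Set (Multiset ℕ)}
    (hE : ∀ d ∈ D, ∀ d' ∈ D', d + d' ∈ E) {P Q : QPoly F n}
    (hP : P ∈ multidegreeIn F n D) (hQ : Q ∈ multidegreeIn F n D') :
    P * Q ∈ multidegreeIn F n E := by
  rw [multidegreeIn_eq_span] at hP hQ
  induction hP, hQ using Submodule.span_induction₂ with
  | mem_mem x y hx hy =>
    obtain ⟨m, w, h, rfl⟩ := hx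
    obtain ⟨m', w', h', rfl⟩ := hy
    rw [quasiTerm_mul]
    exact quasiTerm_mem_multidegreeIn (multidegree_add_append m m' w w' ▸ hE _ h _ h')
  | zero_left y hy => simp
  | zero_right x hx => simp
  | add_left x y z _ _ _ hx hy => rw [add_mul]; exact Submodule.add_mem _ hx hy
  | add_right x y z _ _ _ hx hy => rw [mul_add]; exact Submodule.add_mem _ hx hy
  | smul_left r x y _ _ h => rw [smul_mul_assoc]; exact Submodule.smul_mem _ _ h
  | smul_right r x y _ _ h => rw [mul_smul_comm]; exact Submodule.smul_mem _ _ h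

end QuasiPolynomial
section Multilinear

set_option linter.unusedSectionVars false

variable {F n}

theorem mlTerm_eq_quasiTerm (σ : Equiv.Perm (Fin n)) (k : ℕ) (s t : Fin n → Fin n) :
    mlTerm F n σ k s t = quasiTerm F n
      (((List.finRange n).take k).map fun j => Finsupp.single (s j, t j, (σ j : ℕ)) 1).sum
      (((List.finRange n).drop k).map fun j => (σ j : ℕ)) := by
  have h : ∀ l : List (Fin n),
      (l.map fun j => (MvPolynomial.X (s j, t j, (σ j : ℕ)) : CPoly F n)).prod =
        MvPolynomial.monomial
          (l.map fun j => Finsupp.single (s j, t j, (σ j : ℕ)) 1).sum 1 := by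
    intro l
    induction l with
    | nil => simp
    | cons a l ih =>
      rw [List.map_cons, List.prod_cons, ih, List.map_cons, List.sum_cons, MvPolynomial.X,
        MvPolynomial.monomial_mul, one_mul]
  rw [mlTerm, quasiTerm, h, wordMonomial, List.map_map]
  rfl

theorem multidegree_mlTerm (σ : Equiv.Perm (Fin n)) (k : ℕ) (s t : Fin n → Fin n) :
    multidegree
      (((List.finRange n).take k).map fun j => Finsupp.single (s j, t j, (σ j : ℕ)) 1).sum
      (((List.finRange n).drop k).map fun j => (σ j : ℕ)) = Multiset.range n := by
  have h : ∀ l : List (Fin n),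
      (Finsupp.toMultiset (l.map fun j => Finsupp.single (s j, t j, (σ j : ℕ)) 1).sum).map
        (fun p => p.2.2) = ((l.map fun j => (σ j : ℕ) : List ℕ) : Multiset ℕ) := by
    intro l
    induction l with
    | nil => simp
    | cons a l ih => simp [ih]
  rw [multidegree, h, Multiset.coe_add, ← List.map_append, List.take_append_drop]
  have h1 : ((List.finRange n).map fun j => (σ j : ℕ)) = ((List.finRange n).map σ).map Fin.val := by
    simp
  rw [h1, ← Multiset.coe_range, Multiset.coe_eq_coe, ← List.map_coe_finRange_eq_range]
  refine List.Perm.map _ ((List.perm_ext_iff_of_nodup ?_ (List.nodup_finRange n)).2 ?_)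
  · exact (List.nodup_finRange n).map σ.injective
  · exact fun x => by simpa using ⟨σ.symm x, by simp⟩

theorem IsMultilinearDegN.mem_multidegreeIn {P : QPoly F n} (h : IsMultilinearDegN F n P) :
    P ∈ multidegreeIn F n {Multiset.range n} := by
  refine Submodule.span_le.2 ?_ h
  rintro _ ⟨σ, k, s, t, -, rfl⟩
  rw [mlTerm_eq_quasiTerm]
  exact quasiTerm_mem_multidegreeIn (multidegree_mlTerm σ k s t)

section multidegree

variable {m : Fin n × Fin n × ℕ →₀ ℕ} {w : List ℕ}

theorem card_add_length_of_multidegree (h : multidegree m w = Multiset.range n) :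
    Multiset.card (Finsupp.toMultiset m) + w.length = n := by
  simpa [multidegree] using congrArg Multiset.card h

theorem nodup_of_multidegree (h : multidegree m w = Multiset.range n) :
    (Finsupp.toMultiset m).Nodup ∧ w.Nodup ∧ ∀ p, m p ≠ 0 → p.2.2 ∉ w := by
  have h' := Multiset.nodup_range n
  rw [← h, multidegree, Multiset.nodup_add] at h'
  refine ⟨h'.1.of_map, h'.2.1, fun p hp hw => ?_⟩
  refine Multiset.disjoint_left.1 h'.2.2 (Multiset.mem_map_of_mem _ ?_) hw
  rwa [Finsupp.mem_toMultiset, Finsupp.mem_support_iff]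

theorem eq_of_support_subset_of_multidegree {m' : Fin n × Fin n × ℕ →₀ ℕ}
    (h : multidegree m w = Multiset.range n) (h' : multidegree m' w = Multiset.range n)
    (hs : m'.support ⊆ m.support) : m' = m := by
  rw [← Finsupp.toMultiset_toFinsupp m', ← Finsupp.toMultiset_toFinsupp m]
  congr 1
  apply Multiset.eq_of_le_of_card_le
  · rw [Multiset.le_iff_subset (nodup_of_multidegree h').1]
    intro p hp
    rw [Finsupp.mem_toMultiset] at hp ⊢
    exact hs hp
  · have := card_add_length_of_multidegree h
    have := card_add_length_of_multidegree h'
    lia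

end multidegree

theorem evalC_eq_sum (A : ℕ → Matrix (Fin n) (Fin n) F) (c : CPoly F n) :
    evalC F n A c = ∑ m ∈ c.support, c.coeff m * ∏ p ∈ m.support, A p.2.2 p.1 p.2.1 ^ m p := by
  rw [evalC, MvPolynomial.aeval_def, MvPolynomial.eval₂_eq]
  rfl

theorem evalC_wordCoeff_eq_coeff {P : QPoly F n} (hP : P ∈ multidegreeIn F n {Multiset.range n})
    {w : List ℕ} {m : Fin n × Fin n × ℕ →₀ ℕ} (hm : multidegree m w = Multiset.range n)
    {A : ℕ → Matrix (Fin n) (Fin n) F} (hA : ∀ k ∉ w, ∀ i j, A k i j = (m (i, j, k) : F)) :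
    evalC F n A (wordCoeff w P) = (wordCoeff w P).coeff m := by
  obtain ⟨hnd, -, hdisj⟩ := nodup_of_multidegree hm
  rw [evalC_eq_sum, Finset.sum_eq_single m]
  · rw [Finset.prod_eq_one, mul_one]
    intro p hp
    have hp' : m p ≠ 0 := by simpa using hp
    have h1 : m p ≤ 1 := by
      rw [← Finsupp.count_toMultiset]
      exact Multiset.nodup_iff_count_le_one.1 hnd p
    rw [hA _ (hdisj p hp')]
    simp [show m p = 1 by lia]
  · intro m' hm' hne
    have hm'' := hP w m' (by simpa using hm')
    obtain ⟨p, hp, hp'⟩ := Finset.not_subset.1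
      (fun hs => hne (eq_of_support_subset_of_multidegree hm hm'' hs))
    have hp0 : m' p ≠ 0 := by simpa using hp
    rw [Finset.prod_eq_zero hp, mul_zero]
    rw [hA _ ((nodup_of_multidegree hm'').2.2 p hp0)]
    simp [hp0, show m p = 0 by simpa using hp']
  · intro h
    simp [MvPolynomial.notMem_support_iff.1 h]

theorem evalC_wordCoeff_congr {P : QPoly F n} (hP : P ∈ multidegreeIn F n {Multiset.range n})
    {w : List ℕ} {A B : ℕ → Matrix (Fin n) (Fin n) F} (h : ∀ k ∉ w, A k = B k) :
    evalC F n A (wordCoeff w P) = evalC F n B (wordCoeff w P) := by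
  rw [evalC_eq_sum, evalC_eq_sum]
  refine Finset.sum_congr rfl fun m hm => ?_
  congr 1
  refine Finset.prod_congr rfl fun p hp => ?_
  rw [h _ ((nodup_of_multidegree (hP w m (by simpa using hm))).2.2 p (by simpa using hp))]

theorem length_le_of_wordCoeff_ne_zero {P : QPoly F n}
    (hP : P ∈ multidegreeIn F n {Multiset.range n}) {w : List ℕ} (h : wordCoeff w P ≠ 0) :
    w.length ≤ n := by
  obtain ⟨m, hm⟩ := MvPolynomial.ne_zero_iff.1 h
  have := card_add_length_of_multidegree (hP w m hm)
  lia

theorem wordCoeff_of_length_eq {P : QPoly F n}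
    (hP : P ∈ multidegreeIn F n {Multiset.range n}) {w : List ℕ} (h : w.length = n) :
    wordCoeff w P = MvPolynomial.C ((wordCoeff w P).coeff 0) := by
  ext m
  rw [MvPolynomial.coeff_C]
  split_ifs with h0
  · rw [h0]
  · by_contra hm
    have := card_add_length_of_multidegree (hP w m hm)
    have h1 : Multiset.card (Finsupp.toMultiset m) = 0 := by lia
    rw [Multiset.card_eq_zero] at h1
    rw [← Finsupp.toMultiset_toFinsupp m, h1, map_zero] at h0
    exact h0 rfl

/-- If the only nonzero entry in the rows `a i` of the matrices `A k` is the one describing the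
step of the walk `a` labelled by `W`, then products of the `A k` follow that walk. -/
theorem prod_map_apply_of_walk {A : ℕ → Matrix (Fin n) (Fin n) F} (u : List ℕ) :
    ∀ (a : ℕ → Fin n) (W : List ℕ),
      (∀ i (hi : i < W.length) k c, A k (a i) c = if k = W[i] ∧ c = a (i + 1) then 1 else 0) →
      u.length ≤ W.length → ∀ v,
      (u.map A).prod (a 0) v = if u = W.take u.length ∧ v = a u.length then 1 else 0 := by
  induction u with
  | nil =>
    intro a W _ _ v
    simp [Matrix.one_apply, eq_comm]
  | cons k u ih =>
    intro a W hA hl v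
    cases W with
    | nil => simp at hl
    | cons x W =>
      have ih' := ih (fun i => a (i + 1)) W
        (fun i hi k c => hA (i + 1) (by simpa using hi) k c) (by simpa using hl) v
      have h0 := hA 0 (by simp) k
      simp only [List.getElem_cons_zero, zero_add] at h0 ih'
      rw [List.map_cons, List.prod_cons, Matrix.mul_apply]
      simp only [h0, ite_mul, one_mul, zero_mul, ite_and]
      by_cases hk : k = x
      · simp [hk, ih', ite_and]
      · simp [hk]

theorem eq_zero_of_isQuasiIdentity {P : QPoly F n}
    (hP : P ∈ multidegreeIn F n {Multiset.range n}) (hq : IsQuasiIdentity F n P)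
    (h : ∀ w : List ℕ, w.length = n → wordCoeff w P = 0) : P = 0 := by
  suffices H : ∀ d, ∀ w : List ℕ, n - w.length = d → wordCoeff w P = 0 from
    quasiPoly_ext fun w => by rw [H _ w rfl, map_zero]
  intro d
  induction d using Nat.strong_induction_on with
  | _ d ih =>
  rintro w rfl
  by_contra hw
  have hlt : w.length < n :=
    lt_of_le_of_ne (length_le_of_wordCoeff_ne_zero hP hw) fun h' => hw (h w h')
  have hlong : ∀ u, wordCoeff u P ≠ 0 → u.length ≤ w.length := by
    intro u hu
    by_contra hul
    exact hu (ih (n - u.length) (by lia) u rfl)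
  obtain ⟨m, hm⟩ := MvPolynomial.ne_zero_iff.1 hw
  have hdeg := hP w m hm
  obtain ⟨-, hwnd, hdisj⟩ := nodup_of_multidegree hdeg
  have hcard := card_add_length_of_multidegree hdeg
  set S : Finset (Fin n) := m.support.image fun p => p.1
  have hS : S.card + w.length ≤ n := by
    have h1 : S.card ≤ m.support.card := Finset.card_image_le
    have h2 := Multiset.toFinset_card_le (Finsupp.toMultiset m)
    rw [Finsupp.toFinset_toMultiset] at h2
    lia
  obtain ⟨T, hTS, hT⟩ := Finset.exists_subset_card_eq (s := Sᶜ) (n := w.length)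
    (by rw [Finset.card_compl, Fintype.card_fin]; lia)
  obtain ⟨v₀, -, hv₀⟩ := Finset.exists_mem_notMem_of_card_lt_card (s := T) (t := Finset.univ)
    (by simpa [hT] using hlt)
  set L := T.toList ++ [v₀]
  have hLnd : L.Nodup := by
    rw [List.nodup_append]
    refine ⟨T.nodup_toList, List.nodup_singleton _, ?_⟩
    intro x hx y hy hxy
    rw [List.mem_singleton] at hy
    rw [Finset.mem_toList, hxy, hy] at hx
    exact hv₀ hx
  have hLlen : L.length = w.length + 1 := by simp [L, hT]
  set a : ℕ → Fin n := fun i => L.getD i v₀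
  have ha : ∀ i j, i ≤ w.length → j ≤ w.length → a i = a j → i = j := by
    intro i j hi hj hij
    simp only [a] at hij
    rw [List.getD_eq_getElem _ _ (by lia), List.getD_eq_getElem _ _ (by lia)] at hij
    exact (hLnd.getElem_inj_iff).1 hij
  have haS : ∀ i, i < w.length → a i ∉ S := by
    intro i hi
    have : a i ∈ T := by
      simp only [a, L]
      rw [List.getD_append _ _ _ _ (by simpa [hT] using hi),
        List.getD_eq_getElem _ _ (by simpa [hT] using hi)]
      exact Finset.mem_toList.1 (List.getElem_mem _)
    simpa using hTS this
  let A : ℕ → Matrix (Fin n) (Fin n) F := fun k => Matrix.of fun r c =>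
    if k ∈ w then if r = a (w.idxOf k) ∧ c = a (w.idxOf k + 1) then 1 else 0 else (m (r, c, k) : F)
  have hA : ∀ i (hi : i < w.length) k c,
      A k (a i) c = if k = w[i] ∧ c = a (i + 1) then 1 else 0 := by
    intro i hi k c
    simp only [A, Matrix.of_apply]
    by_cases hk : k ∈ w
    · rw [if_pos hk]
      have hidx := List.idxOf_lt_length_of_mem hk
      have hget : w[w.idxOf k] = k := List.getElem_idxOf hidx
      by_cases hki : k = w[i]
      · have : w.idxOf k = i := by
          rw [hki]
          exact hwnd.idxOf_getElem i hi
        simp [this, ← hki]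
      · rw [if_neg, if_neg]
        · exact fun h' => hki h'.1
        · rintro ⟨h', -⟩
          have := ha _ _ hi.le hidx.le h'
          subst this
          exact hki hget.symm
    · rw [if_neg hk, if_neg]
      · have : m (a i, c, k) = 0 := by
          by_contra hne
          exact haS i hi (Finset.mem_image.2 ⟨(a i, c, k), by simpa using hne, rfl⟩)
        simp [this]
      · rintro ⟨rfl, -⟩
        exact hk (List.getElem_mem _)
  have hwalk := fun u hu => prod_map_apply_of_walk u a w hA hu (a w.length)
  have heval := evalQ_apply_eq_sum A P (a 0) (a w.length)
  rw [hq A, Matrix.zero_apply, Finset.sum_eq_single w, hwalk w le_rfl, if_pos (by simp), mul_one,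
    evalC_wordCoeff_eq_coeff hP hdeg] at heval
  · exact hm heval.symm
  · intro k hk i j
    simp [A, hk]
  · intro u hu hne
    have hul := hlong u (mem_wordSupport.1 hu)
    rw [hwalk u hul, if_neg, mul_zero]
    rintro ⟨h1, h2⟩
    have := ha _ _ le_rfl hul h2
    rw [← this, List.take_length] at h1
    exact hne h1
  · intro hw'
    exact absurd (mem_wordSupport.2 hw) hw'

/-- Evaluation along a walk through all vertices `0, …, n - 1` which is closed up by an edge from
its last vertex to its `i`-th one. -/
theorem coeff_zero_wordCoeff_of_walk {P : QPoly F n}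
    (hP : P ∈ multidegreeIn F n {Multiset.range n}) (hq : IsQuasiIdentity F n P)
    {A : ℕ → Matrix (Fin n) (Fin n) F} {a : ℕ → Fin n} {W : List ℕ} {i : ℕ}
    (hW : W.length = n) (hi : i < n) (ha : ∀ j < n, a j = a i → j = i) (hai : a n = a i)
    (hA : ∀ j (hj : j < W.length) k c,
      A k (a j) c = if k = W[j] ∧ c = a (j + 1) then 1 else 0) :
    (wordCoeff W P).coeff 0 = -evalC F n A (wordCoeff (W.take i) P) := by
  have hne : W.take i ≠ W := by
    intro h
    have := congrArg List.length h
    rw [List.length_take] at this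
    lia
  have heval := evalQ_apply_eq_sum A P (a 0) (a i)
  rw [hq A, Matrix.zero_apply] at heval
  have hprod : ∀ u ∈ wordSupport P, evalC F n A (wordCoeff u P) * (u.map A).prod (a 0) (a i) =
      (if u = W.take i then evalC F n A (wordCoeff u P) else 0) +
        if u = W then evalC F n A (wordCoeff u P) else 0 := by
    intro u hu
    have hul := length_le_of_wordCoeff_ne_zero hP (mem_wordSupport.1 hu)
    rw [prod_map_apply_of_walk u a W hA (by lia) (a i)]
    by_cases h1 : u = W.take i
    · have hlen : u.length = i := by rw [h1, List.length_take]; lia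
      rw [if_pos ⟨by rw [hlen, h1], by rw [hlen]⟩, if_pos h1, if_neg (h1 ▸ hne)]
      simp
    · by_cases h2 : u = W
      · rw [if_pos ⟨by simp [h2], by rw [h2, hW, hai]⟩, if_neg h1, if_pos h2]
        simp
      · rw [if_neg, if_neg h1, if_neg h2]
        · simp
        rintro ⟨h3, h4⟩
        rcases hul.lt_or_eq with h5 | h5
        · rw [ha _ h5 h4.symm] at h3
          exact h1 h3
        · rw [h5, ← hW, List.take_length] at h3
          exact h2 h3
  rw [Finset.sum_congr rfl hprod, Finset.sum_add_distrib, Finset.sum_ite_eq', Finset.sum_ite_eq']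
    at heval
  have hdrop : ∀ u, (if u ∈ wordSupport P then evalC F n A (wordCoeff u P) else 0) =
      evalC F n A (wordCoeff u P) := by
    intro u
    split_ifs with hu
    · rfl
    · rw [mem_wordSupport, not_not] at hu
      rw [hu, map_zero]
  rw [hdrop, hdrop, wordCoeff_of_length_eq hP hW] at heval
  have hC : ∀ c : F, evalC F n A (MvPolynomial.C c) = c := fun c => by simp [evalC]
  rw [hC, add_comm] at heval
  exact eq_neg_of_add_eq_zero_left heval.symm

end Multilinear
section Rotation

set_option linter.unusedSectionVars false

variable {F n}

theorem coeff_zero_wordCoeff_rotate {P : QPoly F n}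
    (hP : P ∈ multidegreeIn F n {Multiset.range n}) (hq : IsQuasiIdentity F n P)
    (p l : List ℕ) (x : ℕ) (hlen : (p ++ x :: l).length = n) :
    (wordCoeff (p ++ x :: l) P).coeff 0 = (wordCoeff (p ++ (l ++ [x])) P).coeff 0 := by
  set W := p ++ x :: l with hWdef
  have hlen' : (p ++ (l ++ [x])).length = n := by
    rw [← hlen, hWdef]
    simp
  have hsum : p.length + l.length + 1 = n := by
    rw [← hlen, hWdef, List.length_append, List.length_cons]
    lia
  set i := p.length with hidef
  have hi : i < n := by lia
  let a : ℕ → Fin n := fun j => if h : j < n then ⟨j, h⟩ else ⟨i, hi⟩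
  have ha : ∀ j < n, (a j : ℕ) = j := fun j hj => by simp [a, hj]
  have han : ∀ j, n ≤ j → (a j : ℕ) = i := fun j hj => by simp [a, hj.not_gt]
  let A : ℕ → Matrix (Fin n) (Fin n) F := fun k => Matrix.of fun r c =>
    if W[(r : ℕ)]? = some k ∧ c = a (r + 1) then 1 else 0
  let B : ℕ → Matrix (Fin n) (Fin n) F := fun k => Matrix.of fun r c =>
    if W[(r : ℕ)]? = some k ∧ c = (if (r : ℕ) + 1 = i then a (i + 1) else a (r + 1)) then 1 else 0
  let b : ℕ → Fin n := fun j => if j < i then a j else if j = n then a (i + 1) else a (j + 1)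
  have hAB : ∀ k ∉ p, A k = B k := by
    intro k hk
    ext r c
    simp only [A, B, Matrix.of_apply]
    by_cases hr : (r : ℕ) + 1 = i
    · have hget : W[(r : ℕ)]? = some (p[(r : ℕ)]'(by lia)) := by
        rw [hWdef, List.getElem?_append_left (by lia), List.getElem?_eq_getElem]
      have hne : W[(r : ℕ)]? ≠ some k := by
        rw [hget]
        intro h
        exact hk (Option.some.inj h ▸ List.getElem_mem _)
      rw [if_neg fun h => hne h.1, if_neg fun h => hne h.1]
    · rw [if_neg hr]
  have htake : W.take i = p := by rw [hWdef, hidef, List.take_left]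
  have htake' : (p ++ (l ++ [x])).take i = p := by rw [hidef, List.take_left]
  rw [coeff_zero_wordCoeff_of_walk hP hq (A := A) (a := a) hlen hi,
    coeff_zero_wordCoeff_of_walk hP hq (A := B) (a := b) hlen' hi, htake, htake',
    evalC_wordCoeff_congr hP hAB]
  · intro j hj hji
    have hji' := congrArg Fin.val hji
    simp only [b, lt_irrefl, if_false, hi.ne, hj.ne] at hji'
    have h1 : (a (i + 1) : ℕ) = if i + 1 < n then i + 1 else i := by
      split_ifs with h
      · exact ha _ h
      · exact han _ (by lia)
    by_cases hjlt : j < i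
    · rw [if_pos hjlt, ha j hj, h1] at hji'
      split_ifs at hji' <;> lia
    · rw [if_neg hjlt, h1] at hji'
      rcases lt_or_ge (j + 1) n with h | h
      · rw [ha _ h] at hji'
        split_ifs at hji' <;> lia
      · rw [han _ h] at hji'
        split_ifs at hji' <;> lia
  · simp [b, hi.not_gt, hi.ne]
  · intro j hj k c
    have hjn : j < n := hlen' ▸ hj
    have hget : W[(b j : ℕ)]? = some ((p ++ (l ++ [x]))[j]) := by
      rw [← List.getElem?_eq_getElem]
      by_cases hjlt : j < i
      · simp only [b, if_pos hjlt, ha j hjn]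
        rw [hWdef, List.getElem?_append_left hjlt, List.getElem?_append_left hjlt]
      · simp only [b, if_neg hjlt, if_neg hjn.ne]
        rw [List.getElem?_append_right (not_lt.1 hjlt)]
        rcases lt_or_ge (j + 1) n with h | h
        · rw [ha _ h, hWdef, List.getElem?_append_right (by lia),
            List.getElem?_append_left (by lia), show j + 1 - p.length = (j - p.length) + 1 by lia,
            List.getElem?_cons_succ]
        · rw [han _ h, hWdef, List.getElem?_append_right (by lia),
            List.getElem?_append_right (by lia), show i - p.length = 0 by lia,
            show j - p.length - l.length = 0 by lia]
          rfl
    have hnext : (if (b j : ℕ) + 1 = i then a (i + 1) else a ((b j : ℕ) + 1)) = b (j + 1) := by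
      by_cases hjlt : j < i
      · have hb : (b j : ℕ) = j := by simp only [b, if_pos hjlt, ha j hjn]
        rw [hb]
        by_cases hji : j + 1 = i
        · simp [b, hji, hi.ne]
        · simp [b, hji, show j + 1 < i by lia]
      · rcases lt_or_ge (j + 1) n with h | h
        · have hb : (b j : ℕ) = j + 1 := by simp only [b, if_neg hjlt, if_neg hjn.ne, ha _ h]
          rw [hb, if_neg (by lia)]
          simp [b, h.ne, show ¬ j + 1 < i by lia]
        · have hb : (b j : ℕ) = i := by simp only [b, if_neg hjlt, if_neg hjn.ne, han _ h]
          rw [hb, if_neg (by lia)]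
          simp [b, show j + 1 = n by lia, hi.not_gt]
    simp only [B, Matrix.of_apply, hget, hnext, Option.some.injEq]
    exact if_congr (and_congr_left fun _ => eq_comm) rfl rfl
  · intro j hj hji
    have hji' := congrArg Fin.val hji
    rwa [ha _ hj, ha _ hi] at hji'
  · exact Fin.ext (by rw [han n le_rfl, ha i hi])
  · intro j hj k c
    have hjn : j < n := hlen ▸ hj
    simp only [A, Matrix.of_apply, ha _ hjn, List.getElem?_eq_getElem hj, Option.some.injEq]
    exact if_congr (and_congr_left fun _ => eq_comm) rfl rfl

theorem coeff_zero_wordCoeff_perm {P : QPoly F n}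
    (hP : P ∈ multidegreeIn F n {Multiset.range n}) (hq : IsQuasiIdentity F n P)
    {u v : List ℕ} (huv : u.Perm v) :
    ∀ p : List ℕ, (p ++ u).length = n →
      (wordCoeff (p ++ u) P).coeff 0 = (wordCoeff (p ++ v) P).coeff 0 := by
  induction huv with
  | nil => exact fun p _ => rfl
  | cons x _ ih =>
    intro p hp
    simpa using ih (p ++ [x]) (by simpa using hp)
  | swap x y l =>
    intro p hp
    have h1 := coeff_zero_wordCoeff_rotate hP hq p (x :: l) y hp
    have h2 := coeff_zero_wordCoeff_rotate hP hq (p ++ [x]) l y (by simpa using hp)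
    rw [h1]
    simpa using h2.symm
  | trans h _ ih ih' =>
    intro p hp
    rw [ih p hp, ih' p (by simpa [h.length_eq] using hp)]

theorem eq_zero_of_coeff_range_eq_zero {P : QPoly F n}
    (hP : P ∈ multidegreeIn F n {Multiset.range n}) (hq : IsQuasiIdentity F n P)
    (h : (wordCoeff (List.range n) P).coeff 0 = 0) : P = 0 := by
  refine eq_zero_of_isQuasiIdentity hP hq fun w hw => ?_
  rw [wordCoeff_of_length_eq hP hw]
  suffices h0 : (wordCoeff w P).coeff 0 = 0 by rw [h0, map_zero]
  by_contra hne
  have hdeg := hP w 0 hne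
  simp only [multidegree, map_zero, Multiset.map_zero, zero_add, Set.mem_singleton_iff,
    ← Multiset.coe_range, Multiset.coe_eq_coe] at hdeg
  have := coeff_zero_wordCoeff_perm hP hq hdeg [] (by simpa using hw)
  exact hne (by simpa [h] using this)

end Rotation

section CayleyHamilton

set_option linter.unusedSectionVars false

variable {F n}

theorem PhiQ_chQSubst (M : Matrix (Fin n) (Fin n) (CPoly F n)) (a : QPoly F n)
    (h : PhiQ F n a = M) : PhiQ F n (chQSubst F n M a) = 0 := by
  have hM := M.aeval_self_charpoly
  rw [Polynomial.aeval_eq_sum_range, Matrix.charpoly_natDegree_eq_dim, Fintype.card_fin] at hM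
  rw [chQSubst, map_sum, ← hM]
  refine Finset.sum_congr rfl fun i _ => ?_
  rw [map_mul, map_pow, h, AlgHom.commutes, ← Algebra.smul_def]

theorem isQuasiIdentity_QnPol : IsQuasiIdentity F n (QnPol F n) := by
  intro A
  rw [QnPol, map_sum]
  refine Finset.sum_eq_zero fun T _ => ?_
  rw [map_smul]
  have h := PhiQ_chQSubst (∑ k ∈ T, genMat F n (k : ℕ))
    (∑ k ∈ T, FreeAlgebra.ι (CPoly F n) (k : ℕ)) (by simp [PhiQ])
  have h' : evalQ F n A (chQSubst F n (∑ k ∈ T, genMat F n (k : ℕ))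
      (∑ k ∈ T, FreeAlgebra.ι (CPoly F n) (k : ℕ))) = 0 := by
    rw [evalQ, AlgHom.comp_apply, AlgHom.restrictScalars_apply, h, map_zero]
  rw [h', smul_zero]

theorem algebraMap_mem_multidegreeIn_card {c : CPoly F n} {d : ℕ} (hc : c.IsHomogeneous d) :
    algebraMap (CPoly F n) (QPoly F n) c ∈ multidegreeIn F n {s | Multiset.card s = d} := by
  intro w m hm
  have h1 : wordCoeff w (algebraMap (CPoly F n) (QPoly F n) c) = if [] = w then c else 0 := by
    have := wordCoeff_algebraMap_mul w c (wordMonomial F n [])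
    rw [wordCoeff_wordMonomial] at this
    simpa [wordMonomial] using this
  rw [h1] at hm
  split_ifs at hm with hw
  · subst hw
    have := hc hm
    rw [Finsupp.weight_apply] at this
    simp only [Pi.one_apply, smul_eq_mul, mul_one] at this
    simp only [multidegree, Multiset.coe_nil, add_zero, Set.mem_ofPred_eq, Multiset.card_map,
      Finsupp.card_toMultiset]
    exact this
  · simp at hm

theorem chQSubst_mem_multidegreeIn (T : Finset (Fin n)) :
    chQSubst F n (∑ k ∈ T, genMat F n (k : ℕ)) (∑ k ∈ T, FreeAlgebra.ι (CPoly F n) (k : ℕ)) ∈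
      multidegreeIn F n {s | Multiset.card s = n} := by
  have hmul : ∀ d e : ℕ, ∀ s ∈ {s : Multiset ℕ | Multiset.card s = d},
      ∀ t ∈ {s : Multiset ℕ | Multiset.card s = e},
      s + t ∈ {s : Multiset ℕ | Multiset.card s = d + e} := by
    rintro d e s rfl t rfl
    simp
  have hι : ∑ k ∈ T, FreeAlgebra.ι (CPoly F n) (k : ℕ) ∈
      multidegreeIn F n {s | Multiset.card s = 1} := by
    refine Submodule.sum_mem _ fun k _ => ?_
    have : FreeAlgebra.ι (CPoly F n) (k : ℕ) = quasiTerm F n 0 [(k : ℕ)] := by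
      simp [quasiTerm, wordMonomial]
    rw [this]
    exact quasiTerm_mem_multidegreeIn (by simp [multidegree])
  have hpow : ∀ i : ℕ, (∑ k ∈ T, FreeAlgebra.ι (CPoly F n) (k : ℕ)) ^ i ∈
      multidegreeIn F n {s | Multiset.card s = i} := by
    intro i
    induction i with
    | zero =>
      rw [pow_zero, ← map_one (algebraMap (CPoly F n) (QPoly F n))]
      exact algebraMap_mem_multidegreeIn_card (MvPolynomial.isHomogeneous_one _ _)
    | succ i ih => exact pow_succ (M := QPoly F n) _ _ ▸ mul_mem_multidegreeIn (hmul i 1) ih hι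
  refine Submodule.sum_mem _ fun i hi => ?_
  have hi' : i ≤ n := by simpa [Nat.lt_succ_iff] using hi
  have hcoeff : ((∑ k ∈ T, genMat F n (k : ℕ)).charpoly.coeff i).IsHomogeneous (n - i) := by
    have h := Matrix.charpoly.univ_coeff_isHomogeneous F (Fin n) i (n - i) (by simp [hi'])
    have h2 := h.eval₂ (MvPolynomial.C (σ := Fin n × Fin n × ℕ))
      (fun q : Fin n × Fin n => (∑ k ∈ T, genMat F n (k : ℕ)) q.1 q.2) (n := 1)
      (fun r => MvPolynomial.isHomogeneous_C _ _) (fun q => by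
        rw [Matrix.sum_apply]
        exact MvPolynomial.IsHomogeneous.sum _ _ _ fun k _ => MvPolynomial.isHomogeneous_X _ _)
    rw [← MvPolynomial.coe_eval₂Hom, Matrix.charpoly.univ_coeff_eval₂Hom, one_mul] at h2
    exact h2
  have := mul_mem_multidegreeIn (hmul (n - i) i) (algebraMap_mem_multidegreeIn_card hcoeff)
    (hpow i)
  rwa [Nat.sub_add_cancel hi'] at this

variable (F n) in
/-- The endomorphism of `C` setting the entries of the generic matrix `ξ_k` to zero. -/
noncomputable def killVarC (k : ℕ) : CPoly F n →ₐ[F] CPoly F n :=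
  MvPolynomial.aeval fun p => if p.2.2 = k then 0 else MvPolynomial.X p

variable (F n) in
/-- The endomorphism of `C⟨X⟩` substituting zero for the variable `x_k`. -/
noncomputable def killVar (k : ℕ) : QPoly F n →+* QPoly F n :=
  (MonoidAlgebra.liftNCRingHom
    ((algebraMap (CPoly F n) (QPoly F n)).comp (killVarC F n k).toRingHom)
    (FreeMonoid.lift fun j => if j = k then 0 else FreeAlgebra.ι (CPoly F n) j)
    fun c _ => Algebra.commutes (killVarC F n k c) _).comp
  (FreeAlgebra.equivMonoidAlgebraFreeMonoid (R := CPoly F n) (X := ℕ)).toRingEquiv.toRingHom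

theorem killVar_algebraMap (k : ℕ) (c : CPoly F n) :
    killVar F n k (algebraMap (CPoly F n) (QPoly F n) c) =
      algebraMap (CPoly F n) (QPoly F n) (killVarC F n k c) := by
  simp [killVar]

theorem killVar_ι (k j : ℕ) :
    killVar F n k (FreeAlgebra.ι (CPoly F n) j) =
      if j = k then 0 else FreeAlgebra.ι (CPoly F n) j := by
  simp [killVar, FreeAlgebra.equivMonoidAlgebraFreeMonoid]

theorem killVar_smul (k : ℕ) (r : F) (x : QPoly F n) :
    killVar F n k (r • x) = r • killVar F n k x := by
  rw [← algebraMap_smul (CPoly F n) r x, Algebra.smul_def, map_mul, killVar_algebraMap,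
    MvPolynomial.algebraMap_eq, killVarC, MvPolynomial.aeval_C, ← Algebra.smul_def,
    algebraMap_smul]

theorem killVarC_monomial (k : ℕ) (m : Fin n × Fin n × ℕ →₀ ℕ) :
    killVarC F n k (MvPolynomial.monomial m 1) =
      if k ∈ (Finsupp.toMultiset m).map (fun p => p.2.2) then 0
      else MvPolynomial.monomial m 1 := by
  rw [killVarC, MvPolynomial.aeval_monomial, map_one, one_mul]
  split_ifs with h
  · obtain ⟨p, hp, hpk⟩ := Multiset.mem_map.1 h
    rw [Finsupp.mem_toMultiset] at hp
    rw [Finsupp.prod]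
    refine Finset.prod_eq_zero hp ?_
    rw [if_pos hpk, zero_pow (by simpa using hp)]
  · rw [MvPolynomial.monomial_eq, map_one, one_mul]
    refine Finset.prod_congr rfl fun p hp => ?_
    beta_reduce
    rw [if_neg]
    exact fun hpk => h (Multiset.mem_map.2 ⟨p, by rwa [Finsupp.mem_toMultiset], hpk⟩)

theorem killVar_wordMonomial (k : ℕ) (w : List ℕ) :
    killVar F n k (wordMonomial F n w) = if k ∈ w then 0 else wordMonomial F n w := by
  induction w with
  | nil => simp [wordMonomial]
  | cons x w ih =>
    have h : wordMonomial F n (x :: w) = FreeAlgebra.ι (CPoly F n) x * wordMonomial F n w := by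
      simp [wordMonomial]
    rw [h, map_mul, ih, killVar_ι]
    by_cases hx : x = k
    · simp [hx]
    · by_cases hw : k ∈ w <;> simp [hw, hx, Ne.symm hx]

theorem killVar_quasiTerm (k : ℕ) (m : Fin n × Fin n × ℕ →₀ ℕ) (w : List ℕ) :
    killVar F n k (quasiTerm F n m w) =
      if k ∈ multidegree m w then 0 else quasiTerm F n m w := by
  rw [quasiTerm, map_mul, killVar_algebraMap, killVarC_monomial, killVar_wordMonomial, multidegree]
  simp only [Multiset.mem_add, Multiset.mem_coe]
  by_cases h1 : k ∈ (Finsupp.toMultiset m).map (fun p => p.2.2) <;> by_cases h2 : k ∈ w <;>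
    simp only [h1, h2, or_true, true_or, or_self, if_true, if_false, map_zero, zero_mul, mul_zero]

theorem coeff_wordCoeff_killVar (k : ℕ) (P : QPoly F n) (w : List ℕ)
    (m : Fin n × Fin n × ℕ →₀ ℕ) :
    (wordCoeff w (killVar F n k P)).coeff m =
      if k ∈ multidegree m w then 0 else (wordCoeff w P).coeff m := by
  have hP : P ∈ multidegreeIn F n Set.univ := fun _ _ _ => Set.mem_univ _
  rw [multidegreeIn_eq_span] at hP
  induction hP using Submodule.span_induction with
  | mem x hx =>
    obtain ⟨m', w', -, rfl⟩ := hx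
    rw [killVar_quasiTerm, coeff_wordCoeff_quasiTerm]
    by_cases h : m' = m ∧ w' = w
    · obtain ⟨rfl, rfl⟩ := h
      split_ifs <;> simp_all [coeff_wordCoeff_quasiTerm]
    · rw [if_neg h, ite_self]
      split_ifs
      · simp
      · rw [coeff_wordCoeff_quasiTerm, if_neg h]
  | zero => simp
  | add x y _ _ hx hy =>
    rw [map_add, map_add, MvPolynomial.coeff_add, hx, hy, map_add, MvPolynomial.coeff_add]
    split_ifs <;> simp
  | smul r x _ hx =>
    rw [killVar_smul, wordCoeff_smul, wordCoeff_smul, MvPolynomial.coeff_smul, MvPolynomial.coeff_smul, hx]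
    split_ifs <;> simp

theorem killVar_chQSubst (k : ℕ) (M : Matrix (Fin n) (Fin n) (CPoly F n)) (a : QPoly F n) :
    killVar F n k (chQSubst F n M a) =
      chQSubst F n (M.map (killVarC F n k)) (killVar F n k a) := by
  rw [chQSubst, chQSubst, map_sum]
  refine Finset.sum_congr rfl fun i _ => ?_
  rw [map_mul, map_pow, killVar_algebraMap]
  have : (M.map (killVarC F n k)).charpoly = M.charpoly.map (killVarC F n k).toRingHom :=
    Matrix.charpoly_map M (killVarC F n k).toRingHom
  rw [this, Polynomial.coeff_map]
  rfl

theorem killVar_QnPol (k : Fin n) : killVar F n k (QnPol F n) = 0 := by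
  set g : Finset (Fin n) → QPoly F n := fun T =>
    killVar F n k (chQSubst F n (∑ j ∈ T, genMat F n (j : ℕ))
      (∑ j ∈ T, FreeAlgebra.ι (CPoly F n) (j : ℕ)))
  have hins : ∀ T : Finset (Fin n), k ∉ T → g (insert k T) = g T := by
    intro T hT
    have h1 : (genMat F n (k : ℕ)).map (killVarC F n k) = 0 := by
      ext1 i j
      simp [genMat, killVarC]
    simp only [g]
    rw [Finset.sum_insert hT, Finset.sum_insert hT, killVar_chQSubst, killVar_chQSubst,
      map_add, killVar_ι, if_pos rfl, zero_add, Matrix.map_add _ (map_add _), h1, zero_add]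
  have hcancel : ∀ T : Finset (Fin n), k ∉ T →
      (-1 : F) ^ (n - T.card) • g T + (-1 : F) ^ (n - (insert k T).card) • g (insert k T) = 0 := by
    intro T hT
    have hc : (insert k T).card ≤ n := by simpa using Finset.card_le_univ (insert k T)
    rw [Finset.card_insert_of_notMem hT] at hc ⊢
    rw [hins T hT, show n - T.card = (n - (T.card + 1)) + 1 by lia, pow_succ,
      ← add_smul, mul_neg_one, neg_add_cancel, zero_smul]
  rw [QnPol, map_sum]
  simp only [killVar_smul]
  refine Finset.sum_involution (fun T _ => if k ∈ T then T.erase k else insert k T) ?_ ?_ ?_ ?_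
  · intro T _
    by_cases hT : k ∈ T
    · have := hcancel (T.erase k) (Finset.notMem_erase k T)
      rw [Finset.insert_erase hT, add_comm] at this
      simpa only [hT, if_true] using this
    · simpa only [hT, if_false] using hcancel T hT
  · intro T _ _ h
    by_cases hT : k ∈ T
    · rw [if_pos hT] at h
      exact Finset.notMem_erase k T (by rw [h]; exact hT)
    · rw [if_neg hT] at h
      exact hT (by rw [← h]; exact Finset.mem_insert_self k T)
  · exact fun T _ => Finset.mem_univ _
  · intro T _
    by_cases hT : k ∈ T <;> simp [hT]

theorem QnPol_mem_multidegreeIn : QnPol F n ∈ multidegreeIn F n {Multiset.range n} := by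
  intro w m hm
  have hcard : Multiset.card (multidegree m w) = n :=
    (Submodule.sum_mem _ fun T _ => Submodule.smul_mem _ _ (chQSubst_mem_multidegreeIn T) :
      QnPol F n ∈ multidegreeIn F n {s | Multiset.card s = n}) w m hm
  have hle : Multiset.range n ≤ multidegree m w := by
    rw [Multiset.le_iff_subset (Multiset.nodup_range n)]
    intro k hk
    by_contra hk'
    have := coeff_wordCoeff_killVar k (QnPol F n) w m
    rw [killVar_QnPol ⟨k, Multiset.mem_range.1 hk⟩, if_neg hk'] at this
    exact hm (by simpa using this.symm)
  exact (Multiset.eq_of_le_of_card_le hle (by simp [hcard])).symm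

theorem shift_pow_apply {R : Type*} [CommRing R] (T : Finset (Fin n))
    (N : Matrix (Fin (n + 1)) (Fin (n + 1)) R)
    (hN : ∀ r c, N r c = if (c : ℕ) = r + 1 ∧ ∃ k ∈ T, (k : ℕ) = r then 1 else 0) (i : ℕ) :
    ∀ c : Fin (n + 1), (N ^ i) 0 c =
      if (c : ℕ) = i ∧ ∀ k : Fin n, (k : ℕ) < i → k ∈ T then 1 else 0 := by
  induction i with
  | zero =>
    intro c
    rw [pow_zero, Matrix.one_apply]
    exact if_congr ⟨fun h => ⟨by rw [← h]; rfl, fun k hk => absurd hk (Nat.not_lt_zero _)⟩,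
      fun h => Fin.ext h.1.symm⟩ rfl rfl
  | succ i ih =>
    intro c
    rw [pow_succ, Matrix.mul_apply]
    simp only [ih, hN, ← ite_and, mul_ite, mul_one, mul_zero]
    by_cases hc : (c : ℕ) = i + 1
    · have hi : i < n + 1 := by have := c.2; lia
      rw [Finset.sum_eq_single ⟨i, hi⟩]
      · refine if_congr ?_ rfl rfl
        constructor
        · rintro ⟨⟨-, k, hk, hki⟩, -, h⟩
          refine ⟨hc, fun j hj => ?_⟩
          rcases Nat.lt_succ_iff_lt_or_eq.1 hj with h' | h'
          · exact h j h'
          · rwa [show j = k from Fin.ext (h'.trans hki.symm)]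
        · rintro ⟨-, h⟩
          exact ⟨⟨hc, ⟨i, by have := c.2; lia⟩, h _ (Nat.lt_succ_self i), rfl⟩, rfl,
            fun k hk => h k (by lia)⟩
      · intro b _ hb
        rw [if_neg]
        exact fun h => hb (Fin.ext h.2.1)
      · simp
    · rw [if_neg fun h => hc h.1]
      refine Finset.sum_eq_zero fun b _ => if_neg ?_
      rintro ⟨⟨h1, -⟩, h2, -⟩
      exact hc (by rw [h1, h2])

theorem QnPol_ne_zero : QnPol F n ≠ 0 := by
  intro h0
  let N : ℕ → Matrix (Fin (n + 1)) (Fin (n + 1)) (CPoly F n) := fun k =>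
    Matrix.of fun r c => if (r : ℕ) = k ∧ (c : ℕ) = k + 1 then 1 else 0
  let θ := FreeAlgebra.lift (CPoly F n) N
  have hN : ∀ T : Finset (Fin n), ∀ r c, (∑ k ∈ T, N k) r c =
      if (c : ℕ) = r + 1 ∧ ∃ k ∈ T, (k : ℕ) = r then 1 else 0 := by
    intro T r c
    rw [Matrix.sum_apply]
    simp only [N, Matrix.of_apply]
    split_ifs with h
    · obtain ⟨hc, k, hk, hkr⟩ := h
      rw [Finset.sum_eq_single_of_mem k hk, if_pos ⟨hkr.symm, by rw [hc, hkr]⟩]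
      intro j _ hj
      rw [if_neg]
      exact fun h' => hj (Fin.ext (h'.1.symm.trans hkr.symm))
    · refine Finset.sum_eq_zero fun k hk => if_neg ?_
      rintro ⟨h1, h2⟩
      exact h ⟨by rw [h2, h1], k, hk, h1.symm⟩
  have hT : ∀ T : Finset (Fin n), θ (chQSubst F n (∑ k ∈ T, genMat F n (k : ℕ))
      (∑ k ∈ T, FreeAlgebra.ι (CPoly F n) (k : ℕ))) 0 (Fin.last n) =
      if T = Finset.univ then 1 else 0 := by
    intro T
    set M := ∑ k ∈ T, genMat F n (k : ℕ)
    have hcoeff : M.charpoly.coeff n = 1 := by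
      have := M.charpoly_monic.coeff_natDegree
      rwa [Matrix.charpoly_natDegree_eq_dim, Fintype.card_fin] at this
    have hθ : θ (∑ k ∈ T, FreeAlgebra.ι (CPoly F n) (k : ℕ)) = ∑ k ∈ T, N k := by
      simp [θ]
    rw [chQSubst, map_sum, Matrix.sum_apply, Finset.sum_eq_single_of_mem n (by simp)]
    · rw [hcoeff, map_one, one_mul, map_pow, hθ, shift_pow_apply T _ (hN T)]
      exact if_congr (by simp [Finset.eq_univ_iff_forall]) rfl rfl
    · intro i _ hi
      rw [← Algebra.smul_def, map_smul, map_pow, hθ, Matrix.smul_apply,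
        shift_pow_apply T _ (hN T), if_neg fun h => hi (by simpa using h.1.symm), smul_zero]
  have hsum : θ (QnPol F n) 0 (Fin.last n) = 1 := by
    rw [QnPol, map_sum, Matrix.sum_apply, Finset.sum_eq_single_of_mem Finset.univ (by simp)]
    · have := hT Finset.univ
      simp only [if_true] at this
      simpa using this
    · intro T _ hne
      have := hT T
      rw [if_neg hne] at this
      rw [← algebraMap_smul (CPoly F n) ((-1 : F) ^ (n - T.card)), map_smul, Matrix.smul_apply,
        this, smul_zero]
  rw [h0] at hsum
  simp at hsum

end CayleyHamilton


theorem stmt2 (F : Type*) [Field F] [CharZero F] (n : ℕ) (hn : 1 ≤ n)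
    (P : QPoly F n) (hml : IsMultilinearDegN F n P) (hP : IsQuasiIdentity F n P) :
    ∃ α : F, P = α • QnPol F n := by
  have hQ : (wordCoeff (List.range n) (QnPol F n)).coeff 0 ≠ 0 := fun h =>
    QnPol_ne_zero (eq_zero_of_coeff_range_eq_zero QnPol_mem_multidegreeIn isQuasiIdentity_QnPol h)
  refine ⟨(wordCoeff (List.range n) P).coeff 0 / (wordCoeff (List.range n) (QnPol F n)).coeff 0,
    sub_eq_zero.1 (eq_zero_of_coeff_range_eq_zero ?_ ?_ ?_)⟩
  · exact Submodule.sub_mem _ hml.mem_multidegreeIn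
      (Submodule.smul_mem _ _ QnPol_mem_multidegreeIn)
  · intro A
    rw [map_sub, map_smul, hP A, isQuasiIdentity_QnPol A, smul_zero, sub_zero]
  · rw [map_sub, wordCoeff_smul, MvPolynomial.coeff_sub, MvPolynomial.coeff_smul, smul_eq_mul,
      div_mul_cancel₀ _ hQ, sub_self]
end
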